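/- arXiv:2508.07463 — 2 statements merged into one kernel-verified Lean document; each statement's English description precedes it below -/
import Mathlib

section
/- There exist a constant C > 0 and a positive integer N, both independent of k, such that for all n ≥ N and all integers k with 6 ≤ k ≤ n!/2, T(n,k) ≤ (1 + C/n²) · (1/n!²) · binom(n!,k). -/
open Equiv Finset

/-- Two `k`-subsets of `Sₙ` are equivalent if one is obtained from the other by
two-sided multiplication `σ ↦ g₁ * σ * g₂` for some pair `(g₁, g₂)`. -/
def permSetRel (n k : ℕ) (x y : {s : Finset (Perm (Fin n)) // s.card = k}) : Prop :=
  ∃ g₁ g₂ : Perm (Fin n),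
    (x : Finset (Perm (Fin n))).image (fun σ => g₁ * σ * g₂) = (y : Finset (Perm (Fin n)))

/-- `T n k` is the number of orbits of the action of `Sₙ × Sₙ` on the family of
`k`-element subsets of `Sₙ`. -/
noncomputable def T (n k : ℕ) : ℕ := Nat.card (Quot (permSetRel n k))


lemma choose_mono_half (d a b : ℕ) (hab : a ≤ b) (hb : 2 * b ≤ d) : d.choose a ≤ d.choose b := by
  induction b, hab using Nat.le_induction with
  | base => exact le_rfl
  | succ b hab ih =>
    exact (ih (by omega)).trans (Nat.choose_le_succ_of_lt_half_left (by omega))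

lemma choose_four_le (d u : ℕ) (h1 : 4 ≤ u) (h2 : u + 4 ≤ d) : d.choose 4 ≤ d.choose u := by
  rcases le_total (2 * u) d with h | h
  · exact choose_mono_half d 4 u h1 h
  · rw [← Nat.choose_symm (show u ≤ d by omega)]
    exact choose_mono_half d 4 (d - u) (by omega) (by omega)

def aa (d t : ℕ) : ℕ := ∑ j ∈ range (t / 2 + 1), d.choose j

lemma choose_mul_pow_le (f M i : ℕ) (h : f ≤ M) : f.choose i * M ^ i ≤ f ^ i * M.choose i := by
  induction i with
  | zero => simp
  | succ i ih =>
    rcases lt_or_ge f (i+1) with hf | hf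
    · simp [Nat.choose_eq_zero_of_lt hf]
    have e1 := Nat.choose_succ_right_eq f i
    have e2 := Nat.choose_succ_right_eq M i
    have e3 : (f - i) * M ≤ f * (M - i) := by
      zify [show i ≤ f by omega, show i ≤ M by omega]
      have : (i:ℤ) * f ≤ i * M := by exact_mod_cast Nat.mul_le_mul_left i h
      nlinarith
    refine Nat.le_of_mul_le_mul_right ?_ (Nat.succ_pos i)
    calc f.choose (i+1) * M ^ (i+1) * (i+1) = (f.choose (i+1) * (i+1)) * (M^i * M) := by ring
      _ = (f.choose i * M^i) * ((f - i) * M) := by rw [e1]; ring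
      _ ≤ (f ^ i * M.choose i) * (f * (M - i)) := Nat.mul_le_mul ih e3
      _ = f ^ (i+1) * (M.choose i * (M - i)) := by ring
      _ = f ^ (i+1) * M.choose (i+1) * (i+1) := by rw [← e2]; ring

lemma choose_sub_le (M k t : ℕ) (hk : 2 * k ≤ M) (ht : t ≤ k) :
    M.choose (k - t) * M ^ t ≤ (2 * k) ^ t * M.choose k := by
  induction t with
  | zero => simp
  | succ t ih =>
    have ih := ih (by omega)
    obtain ⟨j, hj⟩ : ∃ j, k - t = j + 1 := ⟨k - t - 1, by omega⟩
    have hj' : k - (t+1) = j := by omega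
    rw [hj'] ; rw [hj] at ih
    have e := Nat.choose_succ_right_eq M j
    have h1 : M.choose j * M ≤ 2 * k * M.choose (j+1) := by
      calc M.choose j * M ≤ M.choose j * (2 * (M - j)) := Nat.mul_le_mul_left _ (by omega)
        _ = 2 * (M.choose (j+1) * (j+1)) := by rw [e]; ring
        _ ≤ 2 * (M.choose (j+1) * k) := by gcongr; omega
        _ = _ := by ring
    calc M.choose j * M ^ (t+1) = M.choose j * M * M ^ t := by ring
      _ ≤ 2 * k * M.choose (j+1) * M ^ t := Nat.mul_le_mul_right _ h1
      _ = 2 * k * (M.choose (j+1) * M ^ t) := by ring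
      _ ≤ 2 * k * ((2 * k) ^ t * M.choose k) := Nat.mul_le_mul_left _ ih
      _ = _ := by ring

lemma choose_mul_le (a b i j : ℕ) : a.choose i * b.choose j ≤ (a + b).choose (i + j) := by
  rw [Nat.add_choose_eq]
  exact Finset.single_le_sum (f := fun ij : ℕ × ℕ => a.choose ij.1 * b.choose ij.2)
    (fun _ _ => Nat.zero_le _) (Finset.HasAntidiagonal.mem_antidiagonal.2 (show (i, j).1 + (i, j).2 = i + j from rfl))

lemma pow_four_le (d : ℕ) (hd : 6 ≤ d) : d ^ 4 ≤ 384 * d.choose 4 := by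
  have h := Nat.pow_sub_le_descFactorial d 4
  rw [Nat.descFactorial_eq_factorial_mul_choose] at h
  have : d ≤ 2 * (d + 1 - 4) := by omega
  have h2 := Nat.pow_le_pow_left this 4
  rw [mul_pow] at h2
  have : Nat.factorial 4 = 24 := rfl
  rw [this] at h
  omega

lemma aa_large (M D t : ℕ) (hM : 1000 ≤ M) (hD : 31 * M ≤ 32 * D) (hDM : D ≤ M)
    (h6 : 6 ≤ t) (ht : 2 * t ≤ M) : aa (D / 2) t * M ^ 3 ≤ 24576 * D.choose t := by
  set d := D / 2 with hd
  set s := t / 2 with hs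
  obtain ⟨j, hj, hmid⟩ : ∃ j, (j = s ∧ 2 * s ≤ d ∨ j = d / 2 ∧ d ≤ 2 * s) ∧
      ∀ i ≤ s, d.choose i ≤ d.choose j := by
    rcases le_total (2 * s) d with h | h
    · exact ⟨s, Or.inl ⟨rfl, h⟩, fun i hi => choose_mono_half d i s hi h⟩
    · exact ⟨d / 2, Or.inr ⟨rfl, h⟩, fun i hi => Nat.choose_le_middle i d⟩
  have ha : aa d t ≤ (s + 1) * d.choose j := by
    unfold aa
    calc _ ≤ ∑ i ∈ range (t / 2 + 1), d.choose j :=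
          Finset.sum_le_sum (fun i hi => hmid i (by simp at hi; omega))
      _ = _ := by simp [hs]
  have hc : d.choose j * d.choose (t - j) ≤ D.choose t := by
    calc _ ≤ (d + d).choose (j + (t - j)) := choose_mul_le _ _ _ _
      _ = (d + d).choose t := by congr 1; omega
      _ ≤ _ := Nat.choose_le_choose _ (by omega)
  have hMd : M ≤ 4 * d := by omega
  have hM3 : M ^ 3 ≤ 64 * d ^ 3 := by
    calc M ^ 3 ≤ (4 * d) ^ 3 := Nat.pow_le_pow_left hMd 3
      _ = _ := by ring
  have key : (s + 1) * d ^ 3 ≤ 384 * d.choose (t - j) := by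
    by_cases h7 : t = 6
    · have hj3 : j = 3 := by omega
      have hs3 : s = 3 := by omega
      subst h7
      rw [hj3, hs3]
      have h := Nat.pow_sub_le_descFactorial d 3
      rw [Nat.descFactorial_eq_factorial_mul_choose] at h
      have : d ≤ 2 * (d + 1 - 3) := by omega
      have h2 := Nat.pow_le_pow_left this 3
      rw [mul_pow] at h2
      have : Nat.factorial 3 = 6 := rfl
      rw [this] at h
      norm_num at *
      omega
    · have := choose_four_le d (t - j) (by omega) (by omega)
      calc (s + 1) * d ^ 3 ≤ d * d ^ 3 := Nat.mul_le_mul_right _ (by omega)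
        _ = d ^ 4 := by ring
        _ ≤ 384 * d.choose 4 := pow_four_le d (by omega)
        _ ≤ _ := Nat.mul_le_mul_left _ this
  calc aa d t * M ^ 3 ≤ ((s + 1) * d.choose j) * (64 * d ^ 3) := Nat.mul_le_mul ha hM3
    _ = 64 * d.choose j * ((s + 1) * d ^ 3) := by ring
    _ ≤ 64 * d.choose j * (384 * d.choose (t - j)) := Nat.mul_le_mul_left _ key
    _ = 24576 * (d.choose j * d.choose (t - j)) := by ring
    _ ≤ _ := Nat.mul_le_mul_left _ hc

lemma aa_small (M d t : ℕ) (hM : 1 ≤ M) (hd : 2 * d ≤ M) (ht : t ≤ 5) : aa d t ≤ M ^ (t / 2) := by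
  unfold aa
  interval_cases t <;> simp [Finset.sum_range_succ]
  · omega
  · omega
  all_goals
    rcases Nat.eq_zero_or_pos d with h | h
    · subst h; simp; nlinarith
    have := Nat.choose_le_pow d 2
    nlinarith

/-- numeric -/
lemma small_term (M f k t : ℕ) (hM : 1000 ≤ M) (hf : 32 * f ≤ M) (hk : 6 ≤ k) (hkM : 2 * k ≤ M)
    (h1 : 1 ≤ t) (h5 : t ≤ 5) (d : ℕ) (hd : 2 * d ≤ M) :
    ((f.choose (k - t) * aa d t : ℕ) : ℝ) ≤
      32 ^ 7 * ((f / M : ℝ) ^ 3 / M) * M.choose k := by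
  rcases Nat.eq_zero_or_pos f with h0 | hfpos
  · subst h0
    rw [Nat.choose_eq_zero_of_lt (by omega)]
    simp
  have hMpos : (0:ℝ) < M := by positivity
  set p : ℝ := f / M with hp
  have hp0 : 0 < p := by positivity
  have hp32 : p ≤ 1 / 32 := by
    rw [hp, div_le_div_iff₀ hMpos (by norm_num)]; norm_cast; omega
  have hpM : 1 / (M:ℝ) ≤ p := by
    rw [hp]; gcongr; exact_mod_cast hfpos
  set B : ℝ := (M.choose k : ℝ) with hBdef
  have hB : 0 ≤ B := by positivity
  have e1 : (f.choose (k - t) : ℝ) ≤ p ^ (k - t) * M.choose (k - t) := by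
    have := choose_mul_pow_le f M (k - t) (by omega)
    have : (f.choose (k - t) : ℝ) * M ^ (k - t) ≤ f ^ (k - t) * M.choose (k - t) := by
      exact_mod_cast this
    rw [hp, div_pow, div_mul_eq_mul_div, le_div_iff₀ (by positivity)]
    exact this
  have e2 : (M.choose (k - t) : ℝ) ≤ (2 * k) ^ t * B / M ^ t := by
    have := choose_sub_le M k t hkM (by omega)
    rw [le_div_iff₀ (by positivity), hBdef]
    exact_mod_cast this
  have e3 : (aa d t : ℝ) ≤ M ^ (t / 2) := by
    exact_mod_cast aa_small M d t (by omega) hd h5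
  have e4 : ((2 * k : ℝ)) ^ t * p ^ (k - 6) ≤ 32 ^ 7 := by
    calc ((2 * k : ℝ)) ^ t * p ^ (k - 6) ≤ (2 * k) ^ 5 * (1 / 32) ^ (k - 6) := by
          have : (1:ℝ) ≤ 2 * k := by norm_cast; omega
          gcongr
      _ ≤ (2 * 2 ^ k) ^ 5 * (1 / 32) ^ (k - 6) := by
          gcongr
          exact_mod_cast (Nat.lt_two_pow_self).le
      _ = 32 ^ 7 := by
          obtain ⟨r, rfl⟩ : ∃ r, k = r + 6 := ⟨k - 6, by omega⟩
          rw [mul_pow, ← pow_mul, mul_comm (r+6) 5, pow_mul, Nat.add_sub_cancel]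
          norm_num [pow_add]
          have : (32:ℝ)^r * (1/32)^r = 1 := by rw [← mul_pow]; norm_num
          norm_num at this
          linear_combination 34359738368 * this
  have e5 : p ^ (6 - t) * (M ^ (t / 2) / M ^ t : ℝ) ≤ p ^ 3 / M := by
    set y : ℝ := 1 / M with hy
    have hy0 : 0 < y := by positivity
    have hy1 : y ≤ 1 / 32 := hpM.trans hp32
    have hMy : (M:ℝ) = 1 / y := by simp [hy]
    have hp1 : p ≤ 1 := by linarith
    rw [hMy]
    have q1 : y * y ≤ p * p := mul_le_mul hpM hpM hy0.le hp0.le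
    interval_cases t <;> norm_num <;> field_simp
    · nlinarith
    · nlinarith
    · nlinarith
    · nlinarith
    · nlinarith
  calc ((f.choose (k - t) * aa d t : ℕ) : ℝ) = f.choose (k - t) * aa d t := by push_cast; rfl
    _ ≤ (p ^ (k - t) * ((2 * k) ^ t * B / M ^ t)) * M ^ (t / 2) := by
        gcongr
        exact e1.trans (by gcongr)
    _ = ((2 * k) ^ t * p ^ (k - 6)) * (p ^ (6 - t) * (M ^ (t / 2) / M ^ t)) * B := by
        have : k - t = (k - 6) + (6 - t) := by omega
        rw [this, pow_add]; ring
    _ ≤ 32 ^ 7 * (p ^ 3 / M) * B := by gcongr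

open Classical in
lemma two_mul_card_orbits {X : Type*} [Fintype X] (π : Perm X) (U : Finset X)
    (hU : ∀ x ∈ U, π x ∈ U) (hne : ∀ x ∈ U, π x ≠ x) :
    2 * (U.image (Quotient.mk (Perm.SameCycle.setoid π))).card ≤ U.card := by
  rw [mul_comm, mul_comm]
  refine Finset.mul_card_image_le_card U 2 ?_
  intro a ha
  obtain ⟨x, hx, rfl⟩ := Finset.mem_image.1 ha
  rw [Nat.succ_le_iff, Finset.one_lt_card]
  refine ⟨x, by simp [hx], π x, ?_, (hne x hx).symm⟩
  rw [Finset.mem_filter]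
  refine ⟨hU x hx, Quotient.sound ?_⟩
  show Perm.SameCycle π (π x) x
  exact (Perm.sameCycle_apply_left).2 (Perm.SameCycle.refl _ _)

open Classical in
lemma card_small_powerset {Y : Type*} (O : Finset Y) (s d : ℕ) (h : O.card ≤ d) :
    (O.powerset.filter (fun A => A.card ≤ s)).card ≤ ∑ j ∈ range (s + 1), d.choose j := by
  calc _ ≤ ((range (s+1)).biUnion (fun j => O.powersetCard j)).card := by
        apply Finset.card_le_card
        intro A hA
        simp only [Finset.mem_filter, Finset.mem_powerset] at hA
        simp only [Finset.mem_biUnion, Finset.mem_powersetCard, Finset.mem_range]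
        exact ⟨A.card, by omega, hA.1, rfl⟩
    _ ≤ ∑ j ∈ range (s+1), (O.powersetCard j).card := Finset.card_biUnion_le
    _ ≤ _ := Finset.sum_le_sum (fun j _ => by
        rw [Finset.card_powersetCard]; exact Nat.choose_le_choose _ h)

open Classical in
lemma fixed_sets_bound {X : Type*} [Fintype X] (π : Perm X) (k f D : ℕ)
    (hf : (univ.filter (fun x => π x = x)).card = f) (hD : f + D = Fintype.card X) :
    (((univ : Finset X).powersetCard k).filter (fun s => ∀ x ∈ s, π x ∈ s)).card ≤
      ∑ t ∈ range (k + 1), f.choose (k - t) * aa (D / 2) t := by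
  set F := univ.filter (fun x => π x = x) with hF
  set cl := Quotient.mk (Perm.SameCycle.setoid π) with hcl
  set O := (Fᶜ).image cl with hO
  set S := ((univ : Finset X).powersetCard k).filter (fun s => ∀ x ∈ s, π x ∈ s) with hS
  have memF : ∀ x, x ∈ F ↔ π x = x := fun x => by simp [hF]
  have invF : ∀ x, π x ∈ F ↔ x ∈ F := fun x => by simp [memF]
  have hOc : O.card ≤ D / 2 := by
    have h1 := two_mul_card_orbits π (Fᶜ) (fun x hx => by
      rw [Finset.mem_compl] at hx ⊢; rwa [invF]) (fun x hx => by
      rw [Finset.mem_compl, memF] at hx; exact hx)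
    rw [Finset.card_compl, hf] at h1
    change 2 * O.card ≤ _ at h1
    omega
  -- invariance along cycles
  have inv : ∀ s ∈ S, ∀ x ∈ s, ∀ y, Perm.SameCycle π x y → y ∈ s := by
    intro s hs x hx y hxy
    obtain ⟨i, _, hi⟩ := hxy.exists_pow_eq'
    have hs' := (Finset.mem_filter.1 hs).2
    have : ∀ i : ℕ, (π ^ i) x ∈ s := by
      intro i
      induction i with
      | zero => simpa using hx
      | succ i ih => rw [pow_succ', Perm.mul_apply]; exact hs' _ ih
    rw [← hi]; exact this i
  have hmaps : ∀ s ∈ S, (s \ F).card ∈ range (k + 1) := by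
    intro s hs
    have := (Finset.mem_powersetCard.1 (Finset.mem_filter.1 hs).1).2
    have h2 := Finset.card_le_card (Finset.sdiff_subset (s := s) (t := F))
    rw [Finset.mem_range]; omega
  rw [Finset.card_eq_sum_card_fiberwise hmaps]
  refine Finset.sum_le_sum ?_
  intro t ht
  have hbd : ((F.powersetCard (k - t)) ×ˢ (O.powerset.filter (fun A => A.card ≤ t / 2))).card
      ≤ f.choose (k - t) * aa (D / 2) t := by
    rw [Finset.card_product, Finset.card_powersetCard, hf]
    exact Nat.mul_le_mul_left _ (card_small_powerset O (t/2) (D/2) hOc)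
  refine le_trans ?_ hbd
  refine Finset.card_le_card_of_injOn (fun s => (s ∩ F, (s \ F).image cl)) ?_ ?_
  · intro s hs
    have hs := Finset.mem_filter.1 (Finset.mem_coe.1 hs)
    obtain ⟨hsS, hst⟩ := hs
    have hk := (Finset.mem_powersetCard.1 (Finset.mem_filter.1 hsS).1).2
    have hs' := (Finset.mem_filter.1 hsS).2
    simp only [Finset.coe_product, Set.mem_prod, Finset.mem_coe, Finset.mem_powersetCard,
      Finset.mem_filter, Finset.mem_powerset]
    refine ⟨⟨Finset.inter_subset_right, ?_⟩, ?_, ?_⟩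
    · have := Finset.card_inter_add_card_sdiff s F
      omega
    · apply Finset.image_subset_image
      intro x hx
      rw [Finset.mem_compl]; exact (Finset.mem_sdiff.1 hx).2
    · have := two_mul_card_orbits π (s \ F) (fun x hx => by
        rw [Finset.mem_sdiff] at hx ⊢; exact ⟨hs' x hx.1, by rw [invF]; exact hx.2⟩) (fun x hx => by
        rw [Finset.mem_sdiff, memF] at hx; exact hx.2)
      change 2 * ((s \ F).image cl).card ≤ _ at this
      omega
  · have half : ∀ s ∈ S, ∀ s' ∈ S, s ∩ F = s' ∩ F → (s \ F).image cl = (s' \ F).image cl →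
        s ⊆ s' := by
      intro s hs s' hs' h1 h2 x hx
      by_cases hxF : x ∈ F
      · exact (Finset.mem_inter.1 (h1 ▸ Finset.mem_inter.2 ⟨hx, hxF⟩)).1
      · have : cl x ∈ (s' \ F).image cl := h2 ▸ Finset.mem_image_of_mem cl (Finset.mem_sdiff.2 ⟨hx, hxF⟩)
        obtain ⟨y, hy, hyx⟩ := Finset.mem_image.1 this
        have : Perm.SameCycle π y x := Quotient.exact hyx
        exact inv s' hs' y (Finset.mem_sdiff.1 hy).1 x this
    intro s hs s' hs' heq
    have hs := (Finset.mem_filter.1 (Finset.mem_coe.1 hs)).1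
    have hs' := (Finset.mem_filter.1 (Finset.mem_coe.1 hs')).1
    simp only [Prod.mk.injEq] at heq
    exact Finset.Subset.antisymm (half s hs s' hs' heq.1 heq.2)
      (half s' hs' s hs heq.1.symm heq.2.symm)

lemma pow_mul_factorial_le (n m : ℕ) (h : m ≤ n) :
    (n:ℝ) ^ m * (n - m).factorial ≤ 3 ^ m * n.factorial := by
  induction n generalizing m with
  | zero => obtain rfl : m = 0 := by omega
            simp
  | succ n ih =>
    cases m with
    | zero => simp
    | succ m =>
      have hm : m ≤ n := by omega
      have ih := ih m hm
      have h3 : ((n:ℝ) + 1) ^ m ≤ 3 * n ^ m := by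
        rcases Nat.eq_zero_or_pos n with h0 | h0
        · subst h0
          obtain rfl : m = 0 := by omega
          norm_num
        have hn : (0:ℝ) < n := by exact_mod_cast h0
        have : (n:ℝ) + 1 = n * (1 + 1 / n) := by field_simp
        rw [this, mul_pow, mul_comm]
        gcongr
        calc (1 + 1 / (n:ℝ)) ^ m ≤ (Real.exp (1 / n)) ^ m := by
              gcongr
              rw [add_comm]; exact Real.add_one_le_exp _
          _ = Real.exp (m * (1 / n)) := by rw [Real.exp_nat_mul]
          _ ≤ Real.exp 1 := by
              apply Real.exp_le_exp.2
              rw [mul_one_div, div_le_one hn]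
              exact_mod_cast hm
          _ ≤ 3 := by linarith [Real.exp_one_lt_d9]
      rw [Nat.factorial_succ, Nat.add_sub_add_right]
      push_cast
      calc ((n:ℝ) + 1) ^ (m+1) * (n - m).factorial
          = (n + 1) * (((n:ℝ)+1)^m * (n-m).factorial) := by ring
        _ ≤ (n + 1) * ((3 * n ^ m) * (n-m).factorial) := by gcongr
        _ = (n + 1) * 3 * (n ^ m * (n-m).factorial) := by ring
        _ ≤ (n + 1) * 3 * (3 ^ m * n.factorial) := by gcongr
        _ = _ := by ring

lemma cyc_prod_le (s : Multiset ℕ) (N : ℕ) (hN : s.sum ≤ N) :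
    (s.prod * ∏ a ∈ s.toFinset, (s.count a).factorial) ≤ N ^ (Multiset.card s) := by
  rw [Finset.prod_multiset_count, ← Finset.prod_mul_distrib, ← Multiset.toFinset_sum_count_eq,
    ← Finset.prod_pow_eq_pow_sum]
  refine Finset.prod_le_prod' ?_
  intro a ha
  have hle : s.count a * a ≤ N := by
    have : s.sum = ∑ b ∈ s.toFinset, s.count b * b := by
      rw [Finset.sum_multiset_count]; simp
    refine le_trans ?_ (this ▸ hN)
    exact Finset.single_le_sum (f := fun b => s.count b * b) (fun _ _ => Nat.zero_le _) ha
  calc a ^ s.count a * (s.count a).factorial ≤ a ^ s.count a * (s.count a) ^ (s.count a) :=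
        Nat.mul_le_mul_left _ (Nat.factorial_le_pow _)
    _ = (s.count a * a) ^ s.count a := by rw [mul_pow, mul_comm]
    _ ≤ _ := Nat.pow_le_pow_left hle _

lemma centralizer_bound (n : ℕ) (hn : 0 < n) (g : Perm (Fin n)) :
    ((Nat.card (Subgroup.centralizer {g}) : ℝ) / n.factorial) ^ 2 ≤ (9 / n) ^ g.support.card := by
  set m := g.support.card with hm
  have hmn : m ≤ n := by simpa using Finset.card_le_univ g.support
  set c := Multiset.card g.cycleType with hc
  have hcm : 2 * c ≤ m := by
    rw [hm, ← Perm.sum_cycleType, mul_comm]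
    have := Multiset.card_nsmul_le_sum (s := g.cycleType) (a := 2)
      (fun x hx => Perm.two_le_of_mem_cycleType hx)
    simpa using this
  have h1 : Nat.card (Subgroup.centralizer {g}) ≤ (n - m).factorial * n ^ c := by
    rw [Perm.nat_card_centralizer, mul_assoc, Perm.sum_cycleType, Fintype.card_fin]
    refine Nat.mul_le_mul_left _ (cyc_prod_le _ n ?_)
    rw [Perm.sum_cycleType]; exact hmn
  have h1' : (Nat.card (Subgroup.centralizer {g}) : ℝ) ≤ (n - m).factorial * n ^ c := by
    exact_mod_cast h1
  have h2 := pow_mul_factorial_le n m hmn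
  have hn1 : (1:ℝ) ≤ n := by exact_mod_cast hn
  rw [div_pow, div_pow, div_le_div_iff₀ (by positivity) (by positivity)]
  calc (Nat.card (Subgroup.centralizer {g}) : ℝ) ^ 2 * n ^ m
      ≤ (((n - m).factorial : ℝ) * (n:ℝ) ^ c) ^ 2 * (n:ℝ) ^ m := by gcongr
    _ = ((n - m).factorial : ℝ) ^ 2 * (n:ℝ) ^ (2 * c) * (n:ℝ) ^ m := by ring
    _ ≤ ((n - m).factorial : ℝ) ^ 2 * (n:ℝ) ^ m * (n:ℝ) ^ m := by gcongr
    _ = ((n:ℝ) ^ m * ((n - m).factorial : ℝ)) ^ 2 := by ring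
    _ ≤ ((3:ℝ) ^ m * (n.factorial : ℝ)) ^ 2 := by gcongr
    _ = (9:ℝ) ^ m * (n.factorial : ℝ) ^ 2 := by rw [mul_pow, ← pow_mul, mul_comm m 2, pow_mul]; norm_num

lemma card_support_eq_le (n m : ℕ) :
    (univ.filter (fun g : Perm (Fin n) => g.support.card = m)).card ≤ n ^ m := by
  have h1 : (univ.filter (fun g : Perm (Fin n) => g.support.card = m)) ⊆
      ((univ : Finset (Fin n)).powersetCard m).biUnion
        (fun S => (univ : Finset (Perm {x // x ∈ S})).image (fun u => Perm.ofSubtype u)) := by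
    intro g hg
    simp only [Finset.mem_filter, Finset.mem_univ, true_and] at hg
    simp only [Finset.mem_biUnion, Finset.mem_powersetCard, Finset.mem_image, Finset.mem_univ,
      true_and, Finset.subset_univ]
    refine ⟨g.support, hg, g.subtypePerm (fun x => by simp), ?_⟩
    apply Perm.ofSubtype_subtypePerm
    intro x hx; simpa using hx
  calc _ ≤ _ := Finset.card_le_card h1
    _ ≤ ∑ S ∈ (univ : Finset (Fin n)).powersetCard m,
        ((univ : Finset (Perm {x // x ∈ S})).image (fun u => Perm.ofSubtype u)).card :=
        Finset.card_biUnion_le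
    _ ≤ ∑ S ∈ (univ : Finset (Fin n)).powersetCard m, m.factorial := by
        refine Finset.sum_le_sum (fun S hS => ?_)
        refine Finset.card_image_le.trans ?_
        rw [Finset.card_univ, Fintype.card_perm, Fintype.card_coe,
          (Finset.mem_powersetCard.1 hS).2]
    _ = n.descFactorial m := by
        rw [Finset.sum_const, Finset.card_powersetCard, Finset.card_univ, Fintype.card_fin,
          Nat.descFactorial_eq_factorial_mul_choose, smul_eq_mul, mul_comm]
    _ ≤ n ^ m := Nat.descFactorial_le_pow n m

noncomputable def pg (n : ℕ) (g : Perm (Fin n)) : ℝ :=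
  (Nat.card (Subgroup.centralizer {g}) : ℝ) / n.factorial

lemma pg_le (n : ℕ) (hn : 9 ≤ n) (g : Perm (Fin n)) (hg : g ≠ 1) : pg n g ≤ 9 / n := by
  have h := centralizer_bound n (by omega) g
  have h2 := Perm.two_le_card_support_of_ne_one hg
  have hn' : (9:ℝ) ≤ n := by exact_mod_cast hn
  have hq : (9:ℝ) / n ≤ 1 := by rw [div_le_one (by linarith)]; exact hn'
  have h3 : pg n g ^ 2 ≤ (9 / n) ^ 2 :=
    h.trans (pow_le_pow_of_le_one (by positivity) hq h2)
  exact le_of_sq_le_sq h3 (by positivity)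

lemma sum_pg (n : ℕ) (hn : 162 ≤ n) :
    ∑ g ∈ univ.filter (fun g : Perm (Fin n) => g ≠ 1), pg n g ^ 4 ≤ 13122 / (n:ℝ) ^ 2 := by
  have hn' : (162:ℝ) ≤ n := by exact_mod_cast hn
  have hn0 : (0:ℝ) < n := by linarith
  have hmaps : ∀ g ∈ univ.filter (fun g : Perm (Fin n) => g ≠ 1),
      g.support.card ∈ Finset.Ico 2 (n + 1) := by
    intro g hg
    have h2 := Perm.two_le_card_support_of_ne_one (Finset.mem_filter.1 hg).2
    have hmn : g.support.card ≤ n := by simpa using Finset.card_le_univ g.support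
    rw [Finset.mem_Ico]; omega
  rw [← Finset.sum_fiberwise_of_maps_to hmaps]
  set x : ℝ := 81 / n with hx
  have hx0 : 0 ≤ x := by positivity
  have hx2 : x ≤ 1 / 2 := by rw [hx, div_le_div_iff₀ hn0 (by norm_num)]; linarith
  calc _ ≤ ∑ m ∈ Finset.Ico 2 (n+1), x ^ m := by
        refine Finset.sum_le_sum (fun m hm => ?_)
        calc _ ≤ ∑ g ∈ (univ.filter (fun g : Perm (Fin n) => g ≠ 1)).filter
                (fun g => g.support.card = m), ((9 / n : ℝ) ^ m) ^ 2 := by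
              refine Finset.sum_le_sum (fun g hg => ?_)
              have hgm := (Finset.mem_filter.1 hg).2
              have := centralizer_bound n (by omega) g
              rw [hgm] at this
              calc pg n g ^ 4 = (pg n g ^ 2) ^ 2 := by ring
                _ ≤ _ := by gcongr; exact this
          _ ≤ (n:ℝ) ^ m * ((9 / n : ℝ) ^ m) ^ 2 := by
              rw [Finset.sum_const, nsmul_eq_mul]
              gcongr
              have : ((univ.filter (fun g : Perm (Fin n) => g ≠ 1)).filter
                (fun g => g.support.card = m)).card ≤ n ^ m := by
                refine le_trans (Finset.card_le_card ?_) (card_support_eq_le n m)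
                intro g hg
                simp only [Finset.mem_filter, Finset.mem_univ, true_and] at hg ⊢
                exact hg.2
              exact_mod_cast this
          _ = x ^ m := by
              rw [← pow_mul, mul_comm m 2, pow_mul, ← mul_pow, hx]
              congr 1
              field_simp; norm_num
    _ = ∑ i ∈ range (n + 1 - 2), x ^ 2 * x ^ i := by
        rw [Finset.sum_Ico_eq_sum_range]
        refine Finset.sum_congr rfl (fun i _ => by rw [pow_add])
    _ = x ^ 2 * ∑ i ∈ range (n + 1 - 2), x ^ i := by rw [Finset.mul_sum]
    _ ≤ x ^ 2 * 2 := by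
        gcongr
        calc ∑ i ∈ range (n + 1 - 2), x ^ i ≤ ∑ i ∈ range (n + 1 - 2), (1 / 2 : ℝ) ^ i := by
              gcongr
          _ ≤ 2 := sum_geometric_two_le _
    _ = _ := by rw [hx]; field_simp; norm_num

open Classical in
lemma fix_ratio {X : Type*} [Fintype X] (π : Perm X) (M k f : ℕ)
    (hX : Fintype.card X = M)
    (hf : (univ.filter (fun x => π x = x)).card = f)
    (hM : 1000 ≤ M) (hfM : 32 * f ≤ M) (hk : 6 ≤ k) (hkM : 2 * k ≤ M) :
    ((((univ : Finset X).powersetCard k).filter (fun s => ∀ x ∈ s, π x ∈ s)).card : ℝ) ≤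
      ((f / M : ℝ) ^ 6 + 5 * 32 ^ 7 * ((f / M : ℝ) ^ 3 / M) + 24576 / (M:ℝ) ^ 3) * M.choose k := by
  obtain ⟨D, hD⟩ : ∃ D, f + D = M := ⟨M - f, by omega⟩
  have hMpos : (0:ℝ) < M := by positivity
  have h := fixed_sets_bound π k f D hf (by omega)
  have h' : ((((univ : Finset X).powersetCard k).filter (fun s => ∀ x ∈ s, π x ∈ s)).card : ℝ) ≤
      ∑ t ∈ range (k + 1), ((f.choose (k - t) * aa (D / 2) t : ℕ) : ℝ) := by
    exact_mod_cast h
  refine h'.trans ?_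
  set B : ℝ := (M.choose k : ℝ) with hB
  set p : ℝ := (f / M : ℝ) with hp
  have hp0 : 0 ≤ p := by positivity
  have hp1 : p ≤ 1 := by
    rw [hp, div_le_one hMpos]; norm_cast; omega
  have hB0 : 0 ≤ B := by positivity
  rw [Finset.range_eq_Ico, ← Finset.sum_Ico_consecutive _ (Nat.zero_le 6) (by omega : 6 ≤ k + 1)]
  have hlow : ∑ t ∈ Finset.Ico 0 6, ((f.choose (k - t) * aa (D / 2) t : ℕ) : ℝ) ≤
      (p ^ 6 + 5 * 32 ^ 7 * (p ^ 3 / M)) * B := by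
    rw [Finset.sum_eq_sum_Ico_succ_bot (by norm_num)]
    have h0 : ((f.choose (k - 0) * aa (D / 2) 0 : ℕ) : ℝ) ≤ p ^ 6 * B := by
      have e : aa (D / 2) 0 = 1 := by simp [aa]
      rw [e, Nat.sub_zero, mul_one]
      have := choose_mul_pow_le f M k (by omega)
      have : (f.choose k : ℝ) * M ^ k ≤ f ^ k * M.choose k := by exact_mod_cast this
      have h3 : (f.choose k : ℝ) ≤ p ^ k * B := by
        rw [hp, div_pow, div_mul_eq_mul_div, le_div_iff₀ (by positivity)]
        exact this
      refine h3.trans ?_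
      gcongr ?_ * _
      exact pow_le_pow_of_le_one hp0 hp1 hk
    have h1 : ∑ t ∈ Finset.Ico (0 + 1) 6, ((f.choose (k - t) * aa (D / 2) t : ℕ) : ℝ) ≤
        ∑ t ∈ Finset.Ico (0 + 1) 6, 32 ^ 7 * (p ^ 3 / M) * B := by
      refine Finset.sum_le_sum (fun t ht => ?_)
      rw [Finset.mem_Ico] at ht
      exact small_term M f k t hM hfM hk hkM (by omega) (by omega) (D / 2) (by omega)
    rw [Finset.sum_const, Nat.card_Ico] at h1
    norm_num at h1 h0 ⊢
    linarith
  have hhigh : ∑ t ∈ Finset.Ico 6 (k + 1), ((f.choose (k - t) * aa (D / 2) t : ℕ) : ℝ) ≤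
      24576 / (M:ℝ) ^ 3 * B := by
    have hV : B = ∑ t ∈ range (k + 1), ((D.choose t * f.choose (k - t) : ℕ) : ℝ) := by
      rw [hB, ← hD, add_comm f D, Nat.add_choose_eq,
        Finset.Nat.sum_antidiagonal_eq_sum_range_succ (fun i j => D.choose i * f.choose j)]
      push_cast
      rfl
    rw [hV, Finset.mul_sum]
    calc _ ≤ ∑ t ∈ Finset.Ico 6 (k + 1),
          24576 / (M:ℝ) ^ 3 * ((D.choose t * f.choose (k - t) : ℕ) : ℝ) := by
          refine Finset.sum_le_sum (fun t ht => ?_)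
          rw [Finset.mem_Ico] at ht
          have := aa_large M D t hM (by omega) (by omega) ht.1 (by omega)
          have h2 : (aa (D / 2) t : ℝ) * M ^ 3 ≤ 24576 * D.choose t := by exact_mod_cast this
          have h3 : (aa (D / 2) t : ℝ) ≤ 24576 / (M:ℝ) ^ 3 * D.choose t := by
            rw [div_mul_eq_mul_div, le_div_iff₀ (by positivity)]; exact h2
          push_cast
          calc (f.choose (k - t) : ℝ) * aa (D / 2) t
              ≤ f.choose (k - t) * (24576 / (M:ℝ) ^ 3 * D.choose t) := by gcongr
            _ = _ := by ring
      _ ≤ _ := by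
          refine Finset.sum_le_sum_of_subset_of_nonneg ?_ (fun _ _ _ => by positivity)
          intro t ht
          rw [Finset.mem_Ico] at ht
          rw [Finset.mem_range]; exact ht.2
  linarith

/-- the two-sided multiplication homomorphism -/
def Phi (n : ℕ) : Perm (Fin n) × Perm (Fin n) →* Perm (Perm (Fin n)) where
  toFun gh := (Equiv.mulLeft gh.1).trans (Equiv.mulRight gh.2⁻¹)
  map_one' := by ext; simp
  map_mul' a b := by ext; simp [mul_assoc]

lemma Phi_apply (n : ℕ) (g h σ : Perm (Fin n)) : Phi n (g, h) σ = g * σ * h⁻¹ := rfl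

/-- the action on k-subsets -/
@[reducible] def actK (n k : ℕ) : MulAction (Perm (Fin n) × Perm (Fin n))
    {s : Finset (Perm (Fin n)) // s.card = k} where
  smul gh s := ⟨s.1.map (Phi n gh).toEmbedding, by rw [Finset.card_map]; exact s.2⟩
  one_smul s := by
    apply Subtype.ext
    change s.1.map (Phi n 1).toEmbedding = s.1
    rw [map_one]
    exact Finset.map_refl
  mul_smul a b s := by
    apply Subtype.ext
    change s.1.map (Phi n (a * b)).toEmbedding =
      (s.1.map (Phi n b).toEmbedding).map (Phi n a).toEmbedding
    rw [map_mul, Finset.map_map]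
    rfl

open Classical in
/-- number of invariant sets -/
noncomputable def invCount (n k : ℕ) (gh : Perm (Fin n) × Perm (Fin n)) : ℕ :=
  (((univ : Finset (Perm (Fin n))).powersetCard k).filter (fun s => ∀ x ∈ s, Phi n gh x ∈ s)).card

open Classical in
lemma burnside (n k : ℕ) :
    T n k * (n.factorial) ^ 2 ≤ ∑ gh : Perm (Fin n) × Perm (Fin n), invCount n k gh := by
  let _ := actK n k
  have hB := MulAction.sum_card_fixedBy_eq_card_orbits_mul_card_group
    (Perm (Fin n) × Perm (Fin n)) {s : Finset (Perm (Fin n)) // s.card = k}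
  have hc : Fintype.card (Perm (Fin n) × Perm (Fin n)) = n.factorial ^ 2 := by
    rw [Fintype.card_prod, Fintype.card_perm, Fintype.card_fin, sq]
  rw [hc] at hB
  have hT : T n k ≤ Fintype.card (MulAction.orbitRel.Quotient (Perm (Fin n) × Perm (Fin n))
      {s : Finset (Perm (Fin n)) // s.card = k}) := by
    unfold T
    rw [← Nat.card_eq_fintype_card]
    let φ : MulAction.orbitRel.Quotient (Perm (Fin n) × Perm (Fin n))
      {s : Finset (Perm (Fin n)) // s.card = k} → Quot (permSetRel n k) :=
      Quotient.lift (fun x => Quot.mk (permSetRel n k) x) (by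
        intro a b hab
        obtain ⟨⟨g, h⟩, hgh⟩ := hab
        refine (Quot.sound ⟨g, h⁻¹, ?_⟩).symm
        have := congrArg Subtype.val hgh
        rw [← this]
        change _ = b.1.map (Phi n (g, h)).toEmbedding
        rw [Finset.map_eq_image]
        rfl)
    refine Nat.card_le_card_of_surjective φ ?_
    intro y
    obtain ⟨x, rfl⟩ := Quot.exists_rep y
    exact ⟨Quotient.mk _ x, rfl⟩
  calc _ ≤ _ := Nat.mul_le_mul_right _ hT
    _ = _ := hB.symm
    _ ≤ _ := by
      refine Finset.sum_le_sum (fun gh _ => ?_)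
      unfold invCount
      rw [← Finset.card_univ]
      refine Finset.card_le_card_of_injOn (fun s => s.1.1) ?_ ?_
      · intro s _
        have hs : (s.1.1.map (Phi n gh).toEmbedding) = s.1.1 := congrArg Subtype.val s.2
        simp only [Finset.coe_filter, Set.mem_ofPred_eq, Finset.mem_powersetCard,
          Finset.subset_univ, true_and]
        refine ⟨s.1.2, fun x hx => ?_⟩
        have := Finset.mem_map_of_mem (Phi n gh).toEmbedding hx
        rw [hs] at this
        exact this
      · intro s _ t _ hst
        exact Subtype.ext (Subtype.ext hst)

open Classical in
/-- number of fixed points -/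
noncomputable def fixN (n : ℕ) (gh : Perm (Fin n) × Perm (Fin n)) : ℕ :=
  (univ.filter (fun x => Phi n gh x = x)).card

lemma fixN_le (n : ℕ) (g h : Perm (Fin n)) :
    fixN n (g, h) ≤ Nat.card (Subgroup.centralizer {g}) := by
  classical
  unfold fixN
  rcases Finset.eq_empty_or_nonempty (univ.filter (fun x => Phi n (g, h) x = x)) with h0 | ⟨σ₀, h0⟩
  · simp [h0]
  have key : ∀ σ, Phi n (g, h) σ = σ → g * σ = σ * h := by
    intro σ hσ
    rw [Phi_apply, mul_inv_eq_iff_eq_mul] at hσ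
    exact hσ
  have h0 := key σ₀ (Finset.mem_filter.1 h0).2
  rw [← Fintype.card_coe, ← Nat.card_eq_fintype_card]
  refine Nat.card_le_card_of_injective
    (fun σ => (⟨σ.1 * σ₀⁻¹, ?_⟩ : Subgroup.centralizer {g})) ?_
  · have h1 := key σ.1 (Finset.mem_filter.1 σ.2).2
    rw [Subgroup.mem_centralizer_singleton_iff]
    have h2 : h * σ₀⁻¹ = σ₀⁻¹ * g := by
      rw [mul_inv_eq_iff_eq_mul, mul_assoc, h0, inv_mul_cancel_left]
    first
    | (rw [← mul_assoc, h1, mul_assoc, h2, mul_assoc])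
    | (symm; rw [← mul_assoc, h1, mul_assoc, h2, mul_assoc])
  · intro σ τ hστ
    have := congrArg Subtype.val hστ
    exact Subtype.ext (mul_right_cancel this)

lemma sum_fixN (n : ℕ) (g : Perm (Fin n)) : ∑ h, fixN n (g, h) ≤ n.factorial := by
  classical
  unfold fixN
  simp_rw [Finset.card_filter]
  rw [Finset.sum_comm]
  calc _ ≤ ∑ σ : Perm (Fin n), 1 := by
        refine Finset.sum_le_sum (fun σ _ => ?_)
        rw [← Finset.card_filter]
        rw [Finset.card_le_one]
        intro a ha b hb
        have ha := (Finset.mem_filter.1 ha).2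
        have hb := (Finset.mem_filter.1 hb).2
        rw [Phi_apply] at ha hb
        have := ha.trans hb.symm
        exact inv_injective (mul_left_cancel this)
    _ = _ := by simp [Fintype.card_perm]

lemma fixN_one (n : ℕ) (h : Perm (Fin n)) (hh : h ≠ 1) : fixN n (1, h) = 0 := by
  classical
  unfold fixN
  rw [Finset.card_eq_zero, Finset.filter_eq_empty_iff]
  intro σ _ hσ
  rw [Phi_apply, one_mul] at hσ
  apply hh
  have : h⁻¹ = 1 := mul_eq_left.1 hσ
  simpa using this

lemma sq_le_fact (n : ℕ) (hn : 4 ≤ n) : n ^ 2 ≤ n.factorial := by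
  obtain ⟨r, rfl⟩ : ∃ r, n = r + 3 := ⟨n - 3, by omega⟩
  have h1 := Nat.self_le_factorial (r + 1)
  have e : (r + 3).factorial = (r + 3) * ((r + 2) * (r + 1).factorial) := by
    rw [Nat.factorial_succ, Nat.factorial_succ]
  rw [e, sq]
  refine Nat.mul_le_mul_left _ ?_
  refine le_trans ?_ (Nat.mul_le_mul_left (r + 2) h1)
  nlinarith

lemma fix_ratio_phi (n k : ℕ) (gh : Perm (Fin n) × Perm (Fin n)) (M : ℕ)
    (hcard : Fintype.card (Perm (Fin n)) = M)
    (hM : 1000 ≤ M) (hfM : 32 * fixN n gh ≤ M) (hk : 6 ≤ k) (hkM : 2 * k ≤ M) :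
    (invCount n k gh : ℝ) ≤
      ((fixN n gh / M : ℝ) ^ 6 + 5 * 32 ^ 7 * ((fixN n gh / M : ℝ) ^ 3 / M) + 24576 / (M:ℝ) ^ 3)
        * M.choose k := by
  have := fix_ratio (Phi n gh) M k (fixN n gh) hcard (by unfold fixN; congr!) hM hfM hk hkM
  unfold invCount
  convert this

lemma invCount_le (n k : ℕ) (gh : Perm (Fin n) × Perm (Fin n)) (M : ℕ)
    (hcard : Fintype.card (Perm (Fin n)) = M) : (invCount n k gh : ℝ) ≤ (M.choose k : ℝ) := by
  have : invCount n k gh ≤ M.choose k := by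
    unfold invCount
    refine (Finset.card_filter_le _ _).trans ?_
    rw [Finset.card_powersetCard, Finset.card_univ, hcard]
  exact_mod_cast this

/-- There are `C > 0` and a positive integer `N`, independent of `k`, such that for all
`n ≥ N` and all `6 ≤ k ≤ n!/2`, `T(n,k) ≤ (1 + C/n²)·(1/n!²)·binom(n!,k)`. -/
theorem T_upper_bound_large_k :
    ∃ C : ℝ, 0 < C ∧ ∃ N : ℕ, 0 < N ∧ ∀ n : ℕ, N ≤ n → ∀ k : ℕ, 6 ≤ k →
      2 * k ≤ n.factorial →
      (T n k : ℝ) ≤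
        (1 + C / (n : ℝ) ^ 2) * ((n.factorial.choose k : ℝ) / (n.factorial : ℝ) ^ 2) := by
  classical
  refine ⟨13122 + 81 * (5 * 32 ^ 7) + 24576, by norm_num, 1000, by norm_num, ?_⟩
  intro n hn k hk hkM
  set M := n.factorial with hM
  have hn' : (1000:ℝ) ≤ n := by exact_mod_cast hn
  have hn0 : (0:ℝ) < n := by linarith
  have hMn : n ^ 2 ≤ M := by
    exact sq_le_fact n (by omega)
  have hM1000 : 1000 ≤ M := by nlinarith
  have hMpos : (0:ℝ) < M := by positivity
  have hMn' : (n:ℝ) ^ 2 ≤ M := by exact_mod_cast hMn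
  set B : ℝ := (M.choose k : ℝ) with hB
  have hB0 : 0 ≤ B := by positivity
  have hcard : Fintype.card (Perm (Fin n)) = M := by simp [Fintype.card_perm, hM]
  set E : ℝ := 5 * 32 ^ 7 with hE
  have hE0 : 0 ≤ E := by rw [hE]; positivity
  -- p values
  have hpg0 : ∀ g, 0 ≤ pg n g := fun g => by unfold pg; positivity
  have hple : ∀ g h, ((fixN n (g, h) : ℝ) / M) ≤ pg n g := by
    intro g h
    unfold pg
    have : (fixN n (g, h) : ℝ) ≤ Nat.card (Subgroup.centralizer {g}) := by
      exact_mod_cast fixN_le n g h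
    gcongr
  have hpg32 : ∀ g, g ≠ 1 → pg n g ≤ 1 / 32 := by
    intro g hg
    refine (pg_le n (by omega) g hg).trans ?_
    rw [div_le_div_iff₀ hn0 (by norm_num)]; linarith
  have hpoint : ∀ g h : Perm (Fin n), (invCount n k (g, h) : ℝ) ≤
      (if (g, h) = (1 : Perm (Fin n) × Perm (Fin n)) then B else 0) +
      (if g ≠ 1 then (pg n g ^ 5 + E * (pg n g ^ 2 / M)) * (fixN n (g, h) / M) else 0) * B
      + 24576 / (M:ℝ) ^ 3 * B := by
    intro g h
    have hK : 0 ≤ 24576 / (M:ℝ) ^ 3 * B := by positivity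
    by_cases h1 : (g, h) = (1 : Perm (Fin n) × Perm (Fin n))
    · have hg : g = 1 := congrArg Prod.fst h1
      rw [if_pos h1, if_neg (by simpa using hg)]
      have : (invCount n k (g, h) : ℝ) ≤ B := invCount_le n k (g, h) M hcard
      linarith
    · rw [if_neg h1]
      by_cases hg : g = 1
      · rw [if_neg (by simpa using hg)]
        have hh : h ≠ 1 := by
          rintro rfl; exact h1 (by rw [hg]; rfl)
        have hf : fixN n (g, h) = 0 := by rw [hg]; exact fixN_one n h hh
        have := fix_ratio_phi n k (g, h) M hcard hM1000 (by omega) hk hkM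
        rw [hf] at this
        refine le_trans this (le_of_eq ?_)
        rw [← hB]
        norm_num
      · rw [if_pos hg]
        have hp := hple g h
        have h32 := hpg32 g hg
        have hf : 32 * fixN n (g, h) ≤ M := by
          have : (fixN n (g, h) : ℝ) / M ≤ 1 / 32 := hp.trans h32
          rw [div_le_div_iff₀ hMpos (by norm_num)] at this
          have h3 : fixN n (g, h) * 32 ≤ 1 * M := by exact_mod_cast this
          omega
        have := fix_ratio_phi n k (g, h) M hcard hM1000 hf hk hkM
        refine le_trans this ?_
        set p : ℝ := (fixN n (g, h) : ℝ) / M with hpdef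
        have hp0 : 0 ≤ p := by positivity
        rw [zero_add, ← add_mul]
        gcongr
        calc p ^ 6 + 5 * 32 ^ 7 * (p ^ 3 / M) = (p ^ 5 + E * (p ^ 2 / M)) * p := by rw [hE]; ring
          _ ≤ _ := by gcongr
  have hbur : (T n k : ℝ) * (M:ℝ) ^ 2 ≤ ∑ g, ∑ h, (invCount n k (g, h) : ℝ) := by
    have := burnside n k
    rw [Fintype.sum_prod_type] at this
    exact_mod_cast this
  have hs1 : ∑ g : Perm (Fin n), ∑ h : Perm (Fin n),
      (if (g, h) = (1 : Perm (Fin n) × Perm (Fin n)) then B else 0) = B := by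
    rw [← Fintype.sum_prod_type (f := fun gh : Perm (Fin n) × Perm (Fin n) => if gh = 1 then B else 0)]
    simp
  have hs2 : ∑ g : Perm (Fin n), ∑ h : Perm (Fin n),
      (if g ≠ 1 then (pg n g ^ 5 + E * (pg n g ^ 2 / M)) * (fixN n (g, h) / M) else 0) * B ≤
      ((13122 + 81 * E) / (n:ℝ) ^ 2) * B := by
    simp_rw [← Finset.sum_mul]
    gcongr
    calc _ ≤ ∑ g : Perm (Fin n),
          ((if g ≠ 1 then pg n g ^ 4 else 0) + E * ((9 / n) ^ 2 / M)) := by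
          refine Finset.sum_le_sum (fun g _ => ?_)
          by_cases hg : g = 1
          · simp [hg]; positivity
          · simp only [ne_eq, hg, not_false_eq_true, if_true]
            rw [← Finset.mul_sum, ← Finset.sum_div]
            have hle1 : (∑ h, (fixN n (g, h) : ℝ)) / M ≤ 1 := by
              rw [div_le_one hMpos]
              exact_mod_cast sum_fixN n g
            have hx := hpg0 g
            have h32 := hpg32 g hg
            calc _ ≤ (pg n g ^ 5 + E * (pg n g ^ 2 / M)) * 1 := by gcongr
              _ = pg n g ^ 5 + E * (pg n g ^ 2 / M) := mul_one _
              _ ≤ _ := by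
                gcongr ?_ + E * (?_ ^ 2 / _)
                · exact pow_le_pow_of_le_one hx (by linarith) (by norm_num)
                · exact pg_le n (by omega) g hg
      _ = ∑ g ∈ univ.filter (fun g : Perm (Fin n) => g ≠ 1), pg n g ^ 4 + E * (9 / n) ^ 2 := by
          rw [Finset.sum_add_distrib, Finset.sum_filter, Finset.sum_const, Finset.card_univ, hcard,
            nsmul_eq_mul]
          congr 1
          field_simp
      _ ≤ 13122 / (n:ℝ) ^ 2 + E * (9 / n) ^ 2 := by
          gcongr
          exact sum_pg n (by omega)
      _ = _ := by field_simp; ring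
  have hs3 : ∑ g : Perm (Fin n), ∑ h : Perm (Fin n), 24576 / (M:ℝ) ^ 3 * B ≤
      24576 / (n:ℝ) ^ 2 * B := by
    simp only [Finset.sum_const, Finset.card_univ, hcard, nsmul_eq_mul]
    calc _ = 24576 / (M:ℝ) * B := by field_simp
      _ ≤ _ := by gcongr
  have htot : (T n k : ℝ) * (M:ℝ) ^ 2 ≤ (1 + (13122 + 81 * E + 24576) / (n:ℝ) ^ 2) * B := by
    refine hbur.trans ?_
    refine (Finset.sum_le_sum (fun g _ => Finset.sum_le_sum (fun h _ => hpoint g h))).trans ?_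
    simp only [Finset.sum_add_distrib]
    rw [hs1]
    have : (1 + (13122 + 81 * E + 24576) / (n:ℝ) ^ 2) * B =
      B + (13122 + 81 * E) / (n:ℝ) ^ 2 * B + 24576 / (n:ℝ) ^ 2 * B := by ring
    rw [this]
    gcongr
  rw [← mul_div_assoc, le_div_iff₀ (by positivity)]
  exact htot
end

section
/- For every fixed integer k ≥ 3 there exists a constant C_k > 0, independent of n, such that for all n with n! ≥ k + 3, T(n,k) ≤ (1 + C_k · n^{−max(2, k−4)}) · (1/n!²) · binom(n!,k). -/
open Equiv Finset

noncomputable def centN {n : ℕ} (g : Perm (Fin n)) : ℕ := Nat.card (Subgroup.centralizer {g})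

def zc (n : ℕ) (m : Multiset ℕ) : ℕ :=
  (n - m.sum).factorial * m.prod * (∏ i ∈ m.toFinset, (m.count i).factorial)

lemma centN_eq {n : ℕ} (g : Perm (Fin n)) : centN g = zc n g.cycleType := by
  unfold centN zc
  rw [Equiv.Perm.nat_card_centralizer]; simp

lemma centN_pos {n : ℕ} (g : Perm (Fin n)) : 0 < centN g := Nat.card_pos

lemma class_mul {n : ℕ} (g : Perm (Fin n)) :
    #{h : Perm (Fin n) | h.cycleType = g.cycleType} * zc n g.cycleType = n.factorial := by
  have := Equiv.Perm.card_of_cycleType_mul_eq (Fin n) g.cycleType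
  rw [Fintype.card_fin, if_pos] at this
  · exact this
  · exact ⟨by simpa using Equiv.Perm.sum_cycleType_le g,
      fun i hi => Equiv.Perm.two_le_of_mem_cycleType hi⟩

/-- Summation over cycle types. -/
lemma sum_types {n : ℕ} (F : Multiset ℕ → ℝ) :
    ∑ g : Perm (Fin n), F g.cycleType =
      n.factorial * ∑ m ∈ univ.image (fun g : Perm (Fin n) => g.cycleType), F m / zc n m := by
  rw [Finset.mul_sum]
  rw [← Finset.sum_fiberwise_of_maps_to (s := univ)
    (t := univ.image (fun g : Perm (Fin n) => g.cycleType)) (g := fun g => g.cycleType)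
    (fun x _ => Finset.mem_image_of_mem _ (mem_univ _))]
  apply Finset.sum_congr rfl
  intro m hm
  obtain ⟨g, -, rfl⟩ := Finset.mem_image.1 hm
  rw [Finset.sum_congr rfl (g := fun _ => F g.cycleType)]
  · rw [Finset.sum_const, nsmul_eq_mul]
    have h := class_mul g
    have hp : (zc n g.cycleType : ℝ) ≠ 0 := by
      rw [← centN_eq]; exact_mod_cast (centN_pos g).ne'
    have h' : (#{h : Perm (Fin n) | h.cycleType = g.cycleType} : ℝ) * zc n g.cycleType
      = n.factorial := by exact_mod_cast h
    rw [← h']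
    field_simp
  · intro x hx
    rw [(Finset.mem_filter.1 hx).2]

lemma prod_le_two_pow (m : Multiset ℕ) : m.prod ≤ 2 ^ m.sum := by
  induction m using Multiset.induction_on with
  | empty => simp
  | cons a s ih =>
    rw [Multiset.prod_cons, Multiset.sum_cons, pow_add]
    exact Nat.mul_le_mul Nat.lt_two_pow_self.le ih

lemma zc_le (n : ℕ) (m : Multiset ℕ) (hm : ∀ i ∈ m, 2 ≤ i) :
    zc n m ≤ (n - m.sum).factorial * 2 ^ m.sum * (m.sum / 2).factorial := by
  unfold zc
  have h1 := prod_le_two_pow m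
  have h2 : (∏ i ∈ m.toFinset, (m.count i).factorial) ≤ (m.sum / 2).factorial := by
    have := Nat.le_of_dvd (Nat.factorial_pos _)
      (Nat.prod_factorial_dvd_factorial_sum m.toFinset (fun i => m.count i))
    rw [Multiset.toFinset_sum_count_eq] at this
    refine this.trans (Nat.factorial_le ?_)
    have := Multiset.card_nsmul_le_sum (s := m) (a := 2) hm
    simp at this
    omega
  gcongr

lemma super (s : ℕ) (hs : 2 ≤ s) :
    (8 : ℝ) ^ s * (s / 2).factorial ≤ Real.exp 1024 * (s - 2).factorial := by
  have h1 : (s/2).factorial * (s - s/2).factorial ≤ s.factorial := by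
    have := Nat.factorial_mul_factorial_dvd_factorial (n := s) (k := s/2) (by omega)
    exact Nat.le_of_dvd (Nat.factorial_pos _) this
  have h2 : s.factorial ≤ 4 ^ s * (s-2).factorial := by
    obtain ⟨t, rfl⟩ : ∃ t, s = t + 2 := ⟨s - 2, by omega⟩
    rw [Nat.factorial_succ, Nat.factorial_succ, ← mul_assoc]
    have : t + 1 + 1 < 2 ^ (t+2) := Nat.lt_two_pow_self
    have : (4:ℕ) ^ (t+2) = 2^(t+2) * 2^(t+2) := by rw [← mul_pow]; norm_num
    rw [this]
    simp only [Nat.add_sub_cancel]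
    gcongr
    omega
  have h3 := Real.pow_div_factorial_le_exp 1024 (by norm_num) (s - s/2)
  have h4 : (32:ℝ) ^ s ≤ 1024 ^ (s - s/2) := by
    rw [show (1024:ℝ) = 32 ^ 2 by norm_num, ← pow_mul]
    exact pow_le_pow_right₀ (by norm_num) (by omega)
  rw [div_le_iff₀ (by positivity)] at h3
  have h5 : ((s/2).factorial : ℝ) * (s - s/2).factorial ≤ 4 ^ s * (s-2).factorial := by
    exact_mod_cast h1.trans h2
  have h6 : (0:ℝ) < (s - s/2).factorial := by positivity
  have h7 : (8:ℝ)^s * 4 ^ s = 32 ^ s := by rw [← mul_pow]; norm_num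
  have h8 : (0:ℝ) < 8 ^ s := by positivity
  have h9 : (0:ℝ) < (s-2).factorial := by positivity
  refine le_of_mul_le_mul_right ?_ h6
  calc (8 : ℝ) ^ s * (s / 2).factorial * (s - s/2).factorial
      = 8 ^ s * ((s / 2).factorial * (s - s/2).factorial) := by ring
    _ ≤ 8 ^ s * (4 ^ s * (s-2).factorial) := by gcongr
    _ = 32 ^ s * (s-2).factorial := by rw [← h7]; ring
    _ ≤ (Real.exp 1024 * (s - s/2).factorial) * (s-2).factorial := by gcongr; linarith
    _ = _ := by ring

lemma zc_le' (n : ℕ) (m : Multiset ℕ) (hm : ∀ i ∈ m, 2 ≤ i) (h2 : 2 ≤ m.sum) (hn : m.sum ≤ n) :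
    (zc n m : ℝ) ≤ Real.exp 1024 * (n - 2).factorial * (1 / 4) ^ m.sum := by
  have h := zc_le n m hm
  set s := m.sum
  have h1 := super s h2
  have h3 : (n - s).factorial * (s - 2).factorial ≤ (n-2).factorial := by
    have := Nat.factorial_mul_factorial_dvd_factorial (n := n - 2) (k := s-2) (by omega)
    rw [show n - 2 - (s - 2) = n - s by omega, mul_comm] at this
    exact Nat.le_of_dvd (Nat.factorial_pos _) this
  have h3' : ((n - s).factorial : ℝ) * (s - 2).factorial ≤ (n-2).factorial := by exact_mod_cast h3
  have h' : (zc n m : ℝ) ≤ (n - s).factorial * 2 ^ s * (s / 2).factorial := by exact_mod_cast h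
  have h4 : (2:ℝ) ^ s = 8 ^ s * (1/4) ^ s := by rw [← mul_pow]; norm_num
  calc (zc n m : ℝ) ≤ (n - s).factorial * 2 ^ s * (s / 2).factorial := h'
    _ = (n - s).factorial * (8 ^ s * (s / 2).factorial) * (1/4)^s := by rw [h4]; ring
    _ ≤ (n - s).factorial * (Real.exp 1024 * (s - 2).factorial) * (1/4)^s := by gcongr
    _ = Real.exp 1024 * ((n - s).factorial * (s - 2).factorial) * (1/4)^s := by ring
    _ ≤ _ := by gcongr

lemma fact_two (n : ℕ) (hn : 2 ≤ n) : ((n-2).factorial : ℝ) * n ^ 2 ≤ 2 * n.factorial := by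
  obtain ⟨t, rfl⟩ : ∃ t, n = t + 2 := ⟨n - 2, by omega⟩
  rw [Nat.factorial_succ, Nat.factorial_succ]
  simp only [Nat.add_sub_cancel]
  push_cast
  have : (0:ℝ) < t.factorial := by positivity
  have : (0:ℝ) ≤ t := by positivity
  nlinarith [mul_nonneg this this, mul_nonneg (mul_nonneg this this) ‹(0:ℝ) < t.factorial›.le, mul_nonneg this ‹(0:ℝ) < t.factorial›.le]

lemma ct_props {n : ℕ} (g : Perm (Fin n)) (hg : g ≠ 1) :
    (∀ i ∈ g.cycleType, 2 ≤ i) ∧ 2 ≤ g.cycleType.sum ∧ g.cycleType.sum ≤ n := by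
  refine ⟨fun i hi => Equiv.Perm.two_le_of_mem_cycleType hi, ?_, ?_⟩
  · rw [Equiv.Perm.sum_cycleType]
    exact Equiv.Perm.two_le_card_support_of_ne_one hg
  · simpa using Equiv.Perm.sum_cycleType_le g

/-- (M) -/
lemma cent_max {n : ℕ} (g : Perm (Fin n)) (hg : g ≠ 1) :
    (centN g : ℝ) ≤ 2 * Real.exp 1024 * (n.factorial / n ^ 2) := by
  obtain ⟨h1, h2, h3⟩ := ct_props g hg
  have hn : 2 ≤ n := h2.trans h3
  have h := zc_le' n _ h1 h2 h3
  rw [← centN_eq] at h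
  have h4 : ((1:ℝ)/4) ^ g.cycleType.sum ≤ 1 := pow_le_one₀ (by norm_num) (by norm_num)
  have h5 : (centN g : ℝ) ≤ Real.exp 1024 * (n - 2).factorial :=
    h.trans (mul_le_of_le_one_right (by positivity) h4)
  have h6 := fact_two n hn
  have hn' : (0:ℝ) < n ^ 2 := by positivity
  rw [mul_div_assoc', le_div_iff₀ hn']
  calc (centN g : ℝ) * n ^ 2 ≤ Real.exp 1024 * (n - 2).factorial * n ^ 2 := by gcongr
    _ = Real.exp 1024 * ((n - 2).factorial * n ^ 2) := by ring
    _ ≤ Real.exp 1024 * (2 * n.factorial) := by gcongr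
    _ = _ := by ring

lemma card_types (I : Finset (Multiset ℕ)) (hI : ∀ m ∈ I, ∀ i ∈ m, 0 < i) (s : ℕ) :
    #{m ∈ I | m.sum = s} ≤ 2 ^ s := by
  have h1 : Fintype.card (Nat.Partition s) ≤ 2 ^ s := by
    calc _ ≤ Fintype.card (Composition s) :=
          Fintype.card_le_of_surjective _ Nat.Partition.ofComposition_surj
      _ = 2 ^ (s-1) := composition_card s
      _ ≤ 2 ^ s := Nat.pow_le_pow_right (by norm_num) (by omega)
  refine le_trans ?_ h1
  rw [← Finset.card_univ, ← Finset.card_image_of_injective (univ : Finset (Nat.Partition s))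
    (f := fun p => p.parts) (fun a b h => Nat.Partition.ext h)]
  apply Finset.card_le_card
  intro m hm
  rw [Finset.mem_filter] at hm
  rw [Finset.mem_image]
  exact ⟨⟨m, fun {i} hi => hI m hm.1 i hi, hm.2⟩, mem_univ _, rfl⟩

lemma sum_quarter (I : Finset (Multiset ℕ)) (hI : ∀ m ∈ I, ∀ i ∈ m, 0 < i) (n : ℕ)
    (hn : ∀ m ∈ I, m.sum ≤ n) : ∑ m ∈ I, ((1:ℝ)/4) ^ m.sum ≤ 2 := by
  rw [← Finset.sum_fiberwise_of_maps_to (s := I) (t := range (n+1)) (g := fun m => m.sum)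
    (fun m hm => by simpa [Nat.lt_succ_iff] using hn m hm)]
  calc _ ≤ ∑ s ∈ range (n+1), ((1:ℝ)/2)^s := by
        apply Finset.sum_le_sum
        intro s _
        rw [Finset.sum_congr rfl (g := fun _ => ((1:ℝ)/4)^s)]
        · rw [Finset.sum_const, nsmul_eq_mul]
          have : (#{m ∈ I | m.sum = s} : ℝ) ≤ 2 ^ s := by exact_mod_cast card_types I hI s
          calc _ ≤ (2:ℝ)^s * (1/4)^s := by gcongr
            _ = _ := by rw [← mul_pow]; norm_num
        · intro m hm
          rw [(Finset.mem_filter.1 hm).2]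
    _ ≤ 2 := sum_geometric_two_le _

/-- (A) -/
lemma cent_sq {n : ℕ} (hn : 2 ≤ n) :
    ∑ g : Perm (Fin n) with g ≠ 1, (centN g : ℝ) ^ 2 ≤
      4 * Real.exp 1024 * ((n.factorial : ℝ) ^ 2 / n ^ 2) := by
  rw [Finset.sum_filter]
  have h0 : ∀ g : Perm (Fin n), (if g ≠ 1 then (centN g : ℝ) ^ 2 else 0) =
      (fun m : Multiset ℕ => if m ≠ 0 then (zc n m : ℝ) ^ 2 else 0) g.cycleType := by
    intro g
    simp only [centN_eq, ne_eq, Equiv.Perm.cycleType_eq_zero]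
  rw [Finset.sum_congr rfl (fun g _ => h0 g), sum_types (fun m => if m ≠ 0 then (zc n m : ℝ) ^ 2 else 0)]
  set I := univ.image (fun g : Perm (Fin n) => g.cycleType) with hIdef
  have hI : ∀ m ∈ I, (∀ i ∈ m, 0 < i) := by
    intro m hm i hi
    obtain ⟨g, -, rfl⟩ := Finset.mem_image.1 hm
    have := Equiv.Perm.two_le_of_mem_cycleType hi
    omega
  have hI2 : ∀ m ∈ I, m.sum ≤ n := by
    intro m hm
    obtain ⟨g, -, rfl⟩ := Finset.mem_image.1 hm
    simpa using Equiv.Perm.sum_cycleType_le g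
  have key : ∑ m ∈ I, (if m ≠ 0 then (zc n m : ℝ) ^ 2 else 0) / zc n m ≤
      ∑ m ∈ I, Real.exp 1024 * (n - 2).factorial * (1 / 4) ^ m.sum := by
    apply Finset.sum_le_sum
    intro m hm
    obtain ⟨g, -, rfl⟩ := Finset.mem_image.1 hm
    by_cases hg : g = 1
    · subst hg
      simp
      positivity
    · obtain ⟨h1, h2, h3⟩ := ct_props g hg
      have h := zc_le' n _ h1 h2 h3
      rw [if_pos (by simpa using hg)]
      refine le_trans (le_of_eq ?_) h
      rw [sq, mul_self_div_self]
  rw [← Finset.mul_sum] at key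
  have h6 := fact_two n hn
  have hn' : (0:ℝ) < n ^ 2 := by positivity
  have hq := sum_quarter I hI n hI2
  have key2 := key.trans (mul_le_mul_of_nonneg_left hq (by positivity))
  rw [mul_div_assoc', le_div_iff₀ hn']
  calc _ ≤ n.factorial * (Real.exp 1024 * (n-2).factorial * 2) * (n:ℝ)^2 := by gcongr
    _ = 2 * Real.exp 1024 * n.factorial * ((n-2).factorial * (n:ℝ)^2) := by ring
    _ ≤ 2 * Real.exp 1024 * n.factorial * (2 * n.factorial) := by gcongr
    _ = _ := by ring

lemma cube_le (e : ℕ) : ((3:ℝ) * e + 1) ^ 3 ≤ 2592 * 2 ^ e := by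
  have h1 := Real.pow_div_factorial_le_exp ((e + 1 : ℝ) * Real.log 2)
    (by have := Real.log_two_gt_d9; positivity) 3
  have h2 : Real.exp ((e + 1 : ℝ) * Real.log 2) = 2 ^ (e+1) := by
    rw [mul_comm, Real.exp_mul, Real.exp_log (by norm_num)]
    exact_mod_cast Real.rpow_natCast 2 (e+1)
  rw [h2] at h1
  have h3 : ((e + 1 : ℝ) * (1/2)) ^ 3 ≤ ((e + 1 : ℝ) * Real.log 2) ^ 3 := by
    have := Real.log_two_gt_d9
    gcongr; linarith
  have h4 : ((3:ℝ) * e + 1) ^ 3 ≤ (3 * (e + 1)) ^ 3 := by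
    gcongr; linarith
  have h5 : ((e + 1 : ℝ) * Real.log 2) ^ 3 ≤ 6 * 2 ^ (e+1) := by
    rw [div_le_iff₀ (by positivity)] at h1
    norm_num [Nat.factorial] at h1
    linarith
  rw [pow_succ (2:ℝ) e] at h5
  have h6 : ((3:ℝ) * (e + 1)) ^ 3 = 216 * ((e + 1 : ℝ) * (1/2)) ^ 3 := by ring
  linarith

lemma two_pow_le (n : ℕ) : 2 ^ n ≤ 2 * n.factorial := by
  induction n with
  | zero => simp
  | succ n ih =>
    rcases Nat.eq_zero_or_pos n with rfl | h
    · simp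
    · rw [pow_succ, Nat.factorial_succ]
      nlinarith

/-- (B) -/
lemma roots_le {n : ℕ} (hn : 1 ≤ n) (p : ℕ) (hp : p = 2 ∨ p = 3) :
    (#{g : Perm (Fin n) | g ^ p = 1} : ℝ) ≤ 5184 * (n.factorial / n ^ 2) := by
  have : Fact p.Prime := ⟨by rcases hp with rfl | rfl <;> norm_num⟩
  have hn' : (0:ℝ) < n ^ 2 := by positivity
  rw [Finset.card_eq_sum_ones, Nat.cast_sum, Finset.sum_filter]
  have h0 : ∀ g : Perm (Fin n), (if g ^ p = 1 then ((1:ℕ) : ℝ) else 0) =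
      (fun m : Multiset ℕ => if (∀ c ∈ m, c = p) then (1:ℝ) else 0) g.cycleType := by
    intro g
    simp only [Equiv.Perm.pow_prime_eq_one_iff, Nat.cast_one]
  rw [Finset.sum_congr rfl (fun g _ => h0 g),
    sum_types (fun m => if (∀ c ∈ m, c = p) then (1:ℝ) else 0)]
  set I := univ.image (fun g : Perm (Fin n) => g.cycleType) with hIdef
  have hI2 : ∀ m ∈ I, m.sum ≤ n := by
    intro m hm
    obtain ⟨g, -, rfl⟩ := Finset.mem_image.1 hm
    simpa using Equiv.Perm.sum_cycleType_le g
  have e1 : ∀ m : Multiset ℕ, (if (∀ c ∈ m, c = p) then (1:ℝ) else 0) / zc n m =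
    if (∀ c ∈ m, c = p) then (1:ℝ) / zc n m else 0 := by
    intro m; split_ifs <;> simp
  simp only [e1]
  rw [← Finset.sum_filter]
  set J := {m ∈ I | ∀ c ∈ m, c = p}
  have hJ : ∀ m ∈ J, m = Multiset.replicate m.card p := fun m hm =>
    Multiset.eq_replicate_card.2 (Finset.mem_filter.1 hm).2
  have hJc : #J ≤ n + 1 := by
    rw [← Finset.card_range (n+1)]
    apply Finset.card_le_card_of_injOn (fun m => m.card)
    · intro m hm
      have h1 := hI2 m (Finset.mem_filter.1 hm).1
      rw [hJ m hm] at h1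
      simp only [Multiset.sum_replicate, smul_eq_mul] at h1
      have : m.card ≤ m.card * p := Nat.le_mul_of_pos_right _ (by rcases hp with rfl | rfl <;> norm_num)
      simp only [Finset.coe_range, Set.mem_Iio]
      omega
    · intro a ha b hb hab
      simp only at hab
      rw [hJ a ha, hJ b hb, hab]
  have hz : ∀ m ∈ J, (1:ℝ) / zc n m ≤ 5184 / (n+1)^3 := by
    intro m hm
    have h1 := hI2 m (Finset.mem_filter.1 hm).1
    have h2 : (n - m.sum).factorial * m.prod ≤ zc n m := by
      unfold zc
      exact Nat.le_mul_of_pos_right _ (Finset.prod_pos fun i _ => Nat.factorial_pos _)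
    rw [hJ m hm] at h1 h2
    rw [hJ m hm]
    set t := m.card
    simp only [Multiset.sum_replicate, smul_eq_mul, Multiset.prod_replicate] at h1 h2
    set e := n - t * p + t with he
    have h3 : 2 ^ e ≤ 2 * zc n (Multiset.replicate t p) := by
      rw [he, pow_add]
      calc _ ≤ 2 * (n - t * p).factorial * p ^ t := by
            gcongr
            · exact two_pow_le _
            · rcases hp with rfl | rfl <;> norm_num
        _ ≤ _ := by rw [mul_assoc]; gcongr
    have h4 : n ≤ 3 * e := by rcases hp with rfl | rfl <;> omega
    have h5 := cube_le e
    have h6 : ((n:ℝ)+1)^3 ≤ (3 * e + 1)^3 := by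
      have : (n:ℝ) ≤ 3 * e := by exact_mod_cast h4
      gcongr
    have h3' : (2:ℝ) ^ e ≤ 2 * zc n (Multiset.replicate t p) := by exact_mod_cast h3
    have hpos : (0:ℝ) < 2 ^ e := by positivity
    rw [div_le_div_iff₀ (by linarith) (by positivity)]
    linarith
  have hs : ∑ m ∈ J, (1:ℝ) / zc n m ≤ 5184 / (n+1)^2 := by
    calc _ ≤ ∑ m ∈ J, (5184:ℝ) / (n+1)^3 := Finset.sum_le_sum hz
      _ = #J * (5184 / (n+1)^3) := by rw [Finset.sum_const, nsmul_eq_mul]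
      _ ≤ (n+1 : ℝ) * (5184 / (n+1)^3) := by
        gcongr; exact_mod_cast hJc
      _ = _ := by field_simp
  calc _ ≤ n.factorial * ((5184:ℝ) / (n+1)^2) := by gcongr
    _ ≤ n.factorial * ((5184:ℝ) / n^2) := by gcongr; linarith
    _ = _ := by ring

section act
variable {G : Type*} [Group G]

/-- the two-sided action as a homomorphism -/
def phi : G × G →* Perm G where
  toFun g := ⟨fun a => g.1 * a * g.2⁻¹, fun a => g.1⁻¹ * a * g.2,
    fun a => by simp [mul_assoc], fun a => by simp [mul_assoc]⟩
  map_one' := by ext a; simp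
  map_mul' g h := by ext a; simp [mul_assoc]

lemma phi_apply (g : G × G) (a : G) : phi g a = g.1 * a * g.2⁻¹ := rfl

variable [Fintype G] [DecidableEq G]

def fixS (g : G × G) : Finset G := {a | phi g a = a}

lemma mem_fixS {g : G × G} {a : G} : a ∈ fixS g ↔ g.1 * a * g.2⁻¹ = a := by
  rw [fixS, Finset.mem_filter, phi_apply]
  simp

def sols (k : ℕ) (g : G × G) (π : Perm (Fin k)) : Finset (Fin k → G) :=
  {a | ∀ i, phi g (a i) = a (π i)}

lemma sols_pow {k : ℕ} {g : G × G} {π : Perm (Fin k)} {a : Fin k → G} (ha : a ∈ sols k g π)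
    (j : ℕ) (i : Fin k) : phi (g ^ j) (a i) = a ((π ^ j) i) := by
  have ha' : ∀ i, phi g (a i) = a (π i) := by simpa [sols] using ha
  induction j generalizing i with
  | zero => simp
  | succ j ih =>
    rw [pow_succ, pow_succ, map_mul, Perm.mul_apply, ha', ih, Perm.mul_apply]

lemma sols_card_le {k : ℕ} (g : G × G) (π : Perm (Fin k)) (E : Finset (Fin k))
    (hE : ∀ i, ∃ j : ℕ, (π ^ j) i ∈ E) (S : Fin k → Finset G)
    (hS : ∀ a ∈ sols k g π, ∀ i ∈ E, a i ∈ S i) : #(sols k g π) ≤ ∏ i ∈ E, #(S i) := by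
  rw [← Finset.card_pi]
  apply Finset.card_le_card_of_injOn (fun a i _ => a i)
  · intro a ha
    rw [Finset.mem_coe, Finset.mem_pi]
    exact fun i hi => hS a ha i hi
  · intro a ha b hb hab
    ext i
    obtain ⟨j, hj⟩ := hE i
    have h1 := sols_pow ha j i
    have h2 := sols_pow hb j i
    have h3 : a ((π ^ j) i) = b ((π ^ j) i) := congrFun (congrFun hab ((π ^ j) i)) hj
    rw [← h1, ← h2] at h3
    exact (phi (g ^ j)).injective h3

lemma sols_mem_fix {k : ℕ} {g : G × G} {π : Perm (Fin k)} {a : Fin k → G} (ha : a ∈ sols k g π)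
    (p : ℕ) (i : Fin k) (hi : (π ^ p) i = i) : a i ∈ fixS (g ^ p) := by
  simp only [fixS, Finset.mem_filter, Finset.mem_univ, true_and]
  rw [sols_pow ha, hi]

lemma fixS_card_le (g : G × G) : #(fixS g) ≤ Nat.card (Subgroup.centralizer {g.1}) := by
  classical
  rcases (fixS g).eq_empty_or_nonempty with h | ⟨b, hb⟩
  · simp [h]
  · rw [Nat.card_eq_fintype_card, ← Finset.card_univ]
    have key : ∀ a ∈ fixS g, a * b⁻¹ ∈ Subgroup.centralizer {g.1} := by
      intro a ha
      rw [mem_fixS] at ha hb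
      rw [Subgroup.mem_centralizer_singleton_iff]
      have h1 : g.2 = b⁻¹ * g.1 * b := by
        rw [mul_inv_eq_iff_eq_mul] at hb
        rw [mul_assoc, hb]; simp
      rw [mul_inv_eq_iff_eq_mul, h1] at ha
      apply mul_right_cancel (b := b)
      simp only [mul_assoc, inv_mul_cancel, mul_one] at ha ⊢
      rw [ha]
    apply Finset.card_le_card_of_injOn
      (fun a => if h : a * b⁻¹ ∈ Subgroup.centralizer {g.1} then ⟨a * b⁻¹, h⟩ else 1)
    · intro a _; simp
    · intro a ha a' ha' h
      simp only [dif_pos (key a ha), dif_pos (key a' ha'), Subtype.mk.injEq] at h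
      exact mul_right_cancel h

lemma sum_fixS (g₁ : G) : ∑ g₂ : G, #(fixS (g₁, g₂)) = Fintype.card G := by
  simp only [fixS, Finset.card_filter]
  rw [Finset.sum_comm]
  rw [← Finset.card_univ, Finset.card_eq_sum_ones]
  apply Finset.sum_congr rfl
  intro a _
  rw [← Finset.card_filter, Finset.card_eq_one]
  refine ⟨a⁻¹ * g₁ * a, ?_⟩
  ext x
  rw [Finset.mem_filter, phi_apply, Finset.mem_singleton]
  simp only [Finset.mem_univ, true_and]
  rw [mul_inv_eq_iff_eq_mul, mul_assoc, eq_inv_mul_iff_mul_eq, eq_comm]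

lemma fixS_one {g : G × G} (hg : g ≠ 1) (h1 : g.1 = 1) : fixS g = ∅ := by
  rw [Finset.eq_empty_iff_forall_notMem]
  intro a ha
  rw [mem_fixS, h1, one_mul] at ha
  apply hg
  ext
  · exact h1
  · simpa using ha

instance actS (k : ℕ) : MulAction (G × G) {s : Finset G // s.card = k} where
  smul g x := ⟨(x : Finset G).map (phi g).toEmbedding, by rw [Finset.card_map, x.2]⟩
  one_smul x := by
    apply Subtype.ext
    change (x : Finset G).map (phi 1).toEmbedding = _
    rw [map_one]
    exact Finset.map_refl
  mul_smul g h x := by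
    apply Subtype.ext
    change (x : Finset G).map (phi (g * h)).toEmbedding =
      ((x : Finset G).map (phi h).toEmbedding).map (phi g).toEmbedding
    rw [Finset.map_map, map_mul]
    rfl

lemma actS_coe (k : ℕ) (g : G × G) (x : {s : Finset G // s.card = k}) :
    ((g • x : {s : Finset G // s.card = k}) : Finset G) =
      (x : Finset G).map (phi g).toEmbedding := rfl

lemma fixedBy_le (k : ℕ) (g : G × G) :
    Fintype.card (MulAction.fixedBy {s : Finset G // s.card = k} g) ≤
      ∑ π : Perm (Fin k), #(sols k g π) := by
  have key : ∀ x : MulAction.fixedBy {s : Finset G // s.card = k} g,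
      ∃ y : (Σ _ : Perm (Fin k), (Fin k → G)), y ∈ univ.sigma (fun π => sols k g π) ∧
        univ.image y.2 = ((x : {s : Finset G // s.card = k}) : Finset G) := by
    rintro ⟨⟨s, hs⟩, hx⟩
    have hx' : s.map (phi g).toEmbedding = s := congrArg Subtype.val hx
    let e : s ≃ Fin k := s.equivFinOfCardEq hs
    have hmem : ∀ a : G, a ∈ s ↔ phi g a ∈ s := by
      intro a
      conv_rhs => rw [← hx']
      simp
    let q : Perm s := (phi g).subtypeEquiv hmem
    refine ⟨⟨(e.symm.trans q).trans e, fun i => (e.symm i : G)⟩, ?_, ?_⟩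
    · simp only [Finset.mem_sigma, Finset.mem_univ, true_and, sols, Finset.mem_filter]
      intro i
      simp [q]
    · ext a
      simp only [Finset.mem_image, Finset.mem_univ, true_and]
      constructor
      · rintro ⟨i, rfl⟩; exact (e.symm i).2
      · intro ha; exact ⟨e ⟨a, ha⟩, by simp⟩
  choose y hy hyx using key
  rw [← Finset.card_sigma, ← Finset.card_univ]
  apply Finset.card_le_card_of_injOn y
  · intro x _; exact hy x
  · intro x _ x' _ h
    apply Subtype.ext; apply Subtype.ext
    rw [← hyx, ← hyx, h]

end act

lemma T_burnside (n k : ℕ) :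
    T n k * n.factorial ^ 2 ≤ n.factorial.choose k +
      ∑ π : Perm (Fin k), ∑ g : Perm (Fin n) × Perm (Fin n) with g ≠ 1, #(sols k g π) := by
  classical
  have h1 : T n k = Nat.card (MulAction.orbitRel.Quotient (Perm (Fin n) × Perm (Fin n))
      {s : Finset (Perm (Fin n)) // s.card = k}) := by
    unfold T
    apply Nat.card_congr
    apply Quot.congrRight
    intro x y
    change _ ↔ x ∈ MulAction.orbit (Perm (Fin n) × Perm (Fin n)) y
    rw [← MulAction.mem_orbit_symm, MulAction.mem_orbit_iff]
    constructor
    · rintro ⟨g₁, g₂, h⟩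
      refine ⟨(g₁, g₂⁻¹), Subtype.ext ?_⟩
      rw [actS_coe, ← h, Finset.map_eq_image]
      congr 1
    · rintro ⟨⟨g₁, g₂⟩, h⟩
      refine ⟨g₁, g₂⁻¹, ?_⟩
      rw [← h, actS_coe, Finset.map_eq_image]
      congr 1
  have h2 := MulAction.sum_card_fixedBy_eq_card_orbits_mul_card_group
    (Perm (Fin n) × Perm (Fin n)) {s : Finset (Perm (Fin n)) // s.card = k}
  have h3 : Fintype.card (Perm (Fin n) × Perm (Fin n)) = n.factorial ^ 2 := by
    rw [Fintype.card_prod, Fintype.card_perm, Fintype.card_fin, sq]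
  rw [h3, ← Nat.card_eq_fintype_card, ← h1] at h2
  rw [← h2, Finset.sum_comm, ← Finset.sum_filter_add_sum_filter_not univ
    (fun g : Perm (Fin n) × Perm (Fin n) => g = 1)]
  apply add_le_add
  · rw [Finset.filter_eq' univ (1 : Perm (Fin n) × Perm (Fin n)), if_pos (mem_univ _),
      Finset.sum_singleton]
    calc _ ≤ Fintype.card {s : Finset (Perm (Fin n)) // s.card = k} :=
          Fintype.card_subtype_le _
      _ = _ := by
        rw [Fintype.card_finset_len, Fintype.card_perm, Fintype.card_fin]
  · apply Finset.sum_le_sum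
    intro g _
    exact fixedBy_le k g

lemma pow_le_fact (m n : ℕ) :
    (n:ℝ) ^ m ≤ (m.factorial * Real.exp (Real.exp 1)) * n.factorial := by
  have h1 := Real.pow_div_factorial_le_exp (n:ℝ) (by positivity) m
  have h2 := Real.pow_div_factorial_le_exp (Real.exp 1) (by positivity) n
  rw [div_le_iff₀ (by positivity)] at h1 h2
  rw [← Real.exp_nat_mul, mul_one] at h2
  calc (n:ℝ)^m ≤ Real.exp n * m.factorial := h1
    _ ≤ (Real.exp (Real.exp 1) * n.factorial) * m.factorial := by gcongr
    _ = _ := by ring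

lemma reps_exist {k : ℕ} (π : Perm (Fin k)) : ∃ E : Finset (Fin k),
    (∀ i, ∃ j : ℕ, (π ^ j) i ∈ E) ∧ 2 * #E + #π.support ≤ 2 * k := by
  classical
  let r : Fin k → Fin k := fun i => (Quotient.mk (Perm.SameCycle.setoid π) i).out
  have hr : ∀ i, π.SameCycle i (r i) := fun i =>
    Perm.SameCycle.symm (Quotient.mk_out (s := Perm.SameCycle.setoid π) i)
  have hr2 : ∀ i j, π.SameCycle i j → r i = r j := fun i j h => by
    have : Quotient.mk (Perm.SameCycle.setoid π) i = Quotient.mk (Perm.SameCycle.setoid π) j :=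
      Quotient.sound (s := Perm.SameCycle.setoid π) h
    simp only [r, this]
  have hrr : ∀ i, r (r i) = r i := fun i => (hr2 _ _ (hr i)).symm
  refine ⟨univ.image r, ?_, ?_⟩
  · intro i
    obtain ⟨j, hj⟩ := (hr i).exists_nat_pow_eq
    exact ⟨j, by rw [hj]; exact Finset.mem_image_of_mem _ (mem_univ _)⟩
  · set E := univ.image r
    have hE : ∀ i ∈ E, r i = i := by
      intro i hi
      obtain ⟨a, -, rfl⟩ := Finset.mem_image.1 hi
      exact hrr a
    have h1 : #(E ∩ π.support) ≤ #(π.support \ E) := by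
      apply Finset.card_le_card_of_injOn π
      · intro i hi
        have hi' := Finset.mem_inter.1 (Finset.mem_coe.1 hi)
        rw [Finset.mem_coe, Finset.mem_sdiff]
        refine ⟨Perm.apply_mem_support.2 hi'.2, fun h => ?_⟩
        have h3 : r i = r (π i) := hr2 _ _ (Perm.sameCycle_apply_right.2 (Perm.SameCycle.refl _ _))
        rw [hE _ h, hE _ hi'.1] at h3
        exact (Perm.mem_support.1 hi'.2) h3.symm
      · exact π.injective.injOn
    have h2 := Finset.card_inter_add_card_sdiff π.support E
    have h3 := Finset.card_inter_add_card_sdiff E π.support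
    rw [Finset.inter_comm] at h2
    have h4 : #(E \ π.support) + #π.support ≤ k := by
      rw [← Finset.card_union_of_disjoint Finset.sdiff_disjoint]
      simpa using Finset.card_le_univ (E \ π.support ∪ π.support)
    omega

section bounds
variable {n : ℕ}

lemma cardG : Fintype.card (Perm (Fin n)) = n.factorial := by
  rw [Fintype.card_perm, Fintype.card_fin]

lemma cent_le (g : Perm (Fin n)) : (centN g : ℝ) ≤ n.factorial := by
  have : centN g ≤ n.factorial := by
    rw [← cardG, ← Nat.card_eq_fintype_card]
    exact Nat.card_le_card_of_injective _ Subtype.val_injective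
  exact_mod_cast this

lemma sum_weight (w : Perm (Fin n) → ℝ) :
    ∑ g : Perm (Fin n) × Perm (Fin n) with g ≠ 1, (#(fixS g) : ℝ) * w g.1 =
      n.factorial * ∑ g : Perm (Fin n) with g ≠ 1, w g := by
  have h1 : ∑ g : Perm (Fin n) × Perm (Fin n) with g ≠ 1, (#(fixS g) : ℝ) * w g.1 =
      ∑ g : Perm (Fin n) × Perm (Fin n), if g.1 ≠ 1 then (#(fixS g) : ℝ) * w g.1 else 0 := by
    rw [Finset.sum_filter]
    apply Finset.sum_congr rfl
    intro g _
    by_cases hg : g = 1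
    · simp [hg]
    · by_cases h1 : g.1 = 1
      · simp [hg, h1, fixS_one hg h1]
      · simp [hg, h1]
  rw [h1, Fintype.sum_prod_type, Finset.mul_sum, Finset.sum_filter]
  apply Finset.sum_congr rfl
  intro g _
  split_ifs with h
  · change ∑ x : Perm (Fin n), (#(fixS (g, x)) : ℝ) * w g = _
    rw [← Finset.sum_mul]
    congr 1
    have := sum_fixS g
    rw [cardG] at this
    exact_mod_cast this
  · simp only [Finset.sum_const_zero]

lemma sum_cent_pow (hn : 1 ≤ n) (p : ℕ) (hp : p = 2 ∨ p = 3) :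
    ∑ g : Perm (Fin n), (centN (g ^ p) : ℝ) ≤
      (5184 + 2 * Real.exp 1024) * ((n.factorial : ℝ) ^ 2 / n ^ 2) := by
  have h := roots_le hn p hp
  calc _ ≤ ∑ g : Perm (Fin n), ((if g ^ p = 1 then (n.factorial : ℝ) else 0) +
        2 * Real.exp 1024 * (n.factorial / n ^ 2)) := by
        apply Finset.sum_le_sum
        intro g _
        split_ifs with h
        · have := cent_le (g ^ p)
          have : 0 ≤ 2 * Real.exp 1024 * ((n.factorial : ℝ) / n ^ 2) := by positivity
          linarith
        · rw [zero_add]; exact cent_max _ h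
    _ = #{g : Perm (Fin n) | g ^ p = 1} * (n.factorial : ℝ) +
        n.factorial * (2 * Real.exp 1024 * (n.factorial / n ^ 2)) := by
        rw [Finset.sum_add_distrib, ← Finset.sum_filter, Finset.sum_const, Finset.sum_const,
          Finset.card_univ, cardG]
        simp
    _ ≤ (5184 * (n.factorial / n ^ 2)) * (n.factorial : ℝ) +
        n.factorial * (2 * Real.exp 1024 * (n.factorial / n ^ 2)) := by gcongr
    _ = _ := by ring

lemma inv_pow_le (hn : 1 ≤ n) {a b : ℕ} (h : b ≤ a) {x : ℝ} (hx : 0 ≤ x) :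
    x / (n:ℝ) ^ a ≤ x / (n:ℝ) ^ b := by
  have : (1:ℝ) ≤ n := by exact_mod_cast hn
  gcongr

/-- Case `|E|` small. -/
lemma case_small {k : ℕ} (hk : 3 ≤ k) (π : Perm (Fin k)) (E : Finset (Fin k))
    (hE : ∀ i, ∃ j : ℕ, (π ^ j) i ∈ E) (hc : #E + 3 ≤ k) :
    ∑ g : Perm (Fin n) × Perm (Fin n) with g ≠ 1, (#(sols k g π) : ℝ) ≤
      (n.factorial : ℝ) ^ (k - 1) := by
  have h1 : ∀ g : Perm (Fin n) × Perm (Fin n), (#(sols k g π) : ℝ) ≤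
      (n.factorial : ℝ) ^ (k - 3) := by
    intro g
    have := sols_card_le g π E hE (fun _ => univ) (fun _ _ _ _ => mem_univ _)
    rw [Finset.prod_const, Finset.card_univ, cardG] at this
    have h2 := this.trans (Nat.pow_le_pow_right (Nat.factorial_pos n) (show #E ≤ k - 3 by omega))
    exact_mod_cast h2
  calc _ ≤ ∑ g : Perm (Fin n) × Perm (Fin n), (#(sols k g π) : ℝ) :=
        Finset.sum_le_sum_of_subset_of_nonneg (Finset.filter_subset _ _)
          (fun _ _ _ => by positivity)
    _ ≤ ∑ g : Perm (Fin n) × Perm (Fin n), (n.factorial : ℝ) ^ (k - 3) :=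
        Finset.sum_le_sum fun g _ => h1 g
    _ = (n.factorial : ℝ) ^ 2 * (n.factorial : ℝ) ^ (k - 3) := by
        rw [Finset.sum_const, Finset.card_univ, Fintype.card_prod, cardG, nsmul_eq_mul]
        push_cast; ring
    _ = _ := by rw [← pow_add]; congr 1; omega

lemma case_pt {k : ℕ} (hk : 3 ≤ k) (π : Perm (Fin k)) (E : Finset (Fin k))
    (hE : ∀ i, ∃ j : ℕ, (π ^ j) i ∈ E) (hc : #E + 2 ≤ k) (i₀ : Fin k) (hi : i₀ ∈ E) (p : ℕ)
    (hp : (π ^ p) i₀ = i₀) :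
    ∑ g : Perm (Fin n) × Perm (Fin n) with g ≠ 1, (#(sols k g π) : ℝ) ≤
      (∑ g : Perm (Fin n) × Perm (Fin n), (#(fixS (g ^ p)) : ℝ)) *
      (n.factorial : ℝ) ^ (k - 3) := by
  have h1 : ∀ g : Perm (Fin n) × Perm (Fin n), (#(sols k g π) : ℝ) ≤
      #(fixS (g ^ p)) * (n.factorial : ℝ) ^ (k - 3) := by
    intro g
    have := sols_card_le g π E hE (fun i => if i = i₀ then fixS (g ^ p) else univ) (by
      intro a ha i _
      split_ifs with h
      · subst h; exact sols_mem_fix ha p _ hp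
      · exact mem_univ _)
    rw [← Finset.mul_prod_erase _ _ hi, if_pos rfl,
      Finset.prod_congr rfl (g := fun _ => n.factorial), Finset.prod_const,
      Finset.card_erase_of_mem hi] at this
    · have h2 := this.trans (Nat.mul_le_mul_left _
        (Nat.pow_le_pow_right (Nat.factorial_pos n) (show #E - 1 ≤ k - 3 by omega)))
      exact_mod_cast h2
    · intro x hx
      rw [if_neg (Finset.ne_of_mem_erase hx), Finset.card_univ, cardG]
  rw [Finset.sum_mul]
  calc _ ≤ ∑ g : Perm (Fin n) × Perm (Fin n), (#(sols k g π) : ℝ) :=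
        Finset.sum_le_sum_of_subset_of_nonneg (Finset.filter_subset _ _)
          (fun _ _ _ => by positivity)
    _ ≤ _ := Finset.sum_le_sum fun g _ => h1 g

lemma case_fix {k : ℕ} (hk : 3 ≤ k) (π : Perm (Fin k)) (E : Finset (Fin k))
    (hE : ∀ i, ∃ j : ℕ, (π ^ j) i ∈ E) (hc : #E + 2 ≤ k) (i₀ : Fin k) (hp : π i₀ = i₀) :
    ∑ g : Perm (Fin n) × Perm (Fin n) with g ≠ 1, (#(sols k g π) : ℝ) ≤
      (n.factorial : ℝ) ^ (k - 1) := by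
  have hi : i₀ ∈ E := by
    obtain ⟨j, hj⟩ := hE i₀
    rwa [Perm.pow_apply_eq_self_of_apply_eq_self hp] at hj
  refine (case_pt hk π E hE hc i₀ hi 1 (by simpa using hp)).trans (le_of_eq ?_)
  have : ∑ g : Perm (Fin n) × Perm (Fin n), (#(fixS (g ^ 1)) : ℝ) = (n.factorial : ℝ) ^ 2 := by
    simp only [pow_one]
    rw [Fintype.sum_prod_type, Finset.sum_congr rfl (g := fun _ => (n.factorial : ℝ))]
    · rw [Finset.sum_const, Finset.card_univ, cardG, nsmul_eq_mul, sq]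
    · intro g _
      have := sum_fixS g
      rw [cardG] at this
      exact_mod_cast this
  rw [this, ← pow_add]; congr 1; omega

lemma case_pow {k : ℕ} (hk : 3 ≤ k) (hn : 1 ≤ n) (π : Perm (Fin k)) (E : Finset (Fin k))
    (hE : ∀ i, ∃ j : ℕ, (π ^ j) i ∈ E) (hc : #E + 2 ≤ k) (p : ℕ) (hp2 : p = 2 ∨ p = 3)
    (hp : π ^ p = 1) :
    ∑ g : Perm (Fin n) × Perm (Fin n) with g ≠ 1, (#(sols k g π) : ℝ) ≤
      (5184 + 2 * Real.exp 1024) * ((n.factorial : ℝ) ^ k / n ^ 2) := by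
  obtain ⟨j, hj⟩ := hE ⟨0, by omega⟩
  refine (case_pt hk π E hE hc _ hj p (by simp [hp])).trans ?_
  have : ∑ g : Perm (Fin n) × Perm (Fin n), (#(fixS (g ^ p)) : ℝ) ≤
      n.factorial * ((5184 + 2 * Real.exp 1024) * ((n.factorial : ℝ) ^ 2 / n ^ 2)) := by
    calc _ ≤ ∑ g : Perm (Fin n) × Perm (Fin n), (centN (g.1 ^ p) : ℝ) := by
          apply Finset.sum_le_sum
          intro g _
          exact_mod_cast fixS_card_le (g ^ p)
      _ = n.factorial * ∑ g : Perm (Fin n), (centN (g ^ p) : ℝ) := by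
          rw [Fintype.sum_prod_type, Finset.mul_sum]
          apply Finset.sum_congr rfl
          intro g _
          change ∑ y : Perm (Fin n), (centN (g ^ p) : ℝ) = _
          rw [Finset.sum_const, Finset.card_univ, cardG, nsmul_eq_mul]
      _ ≤ _ := by gcongr; exact sum_cent_pow hn p hp2
  calc _ ≤ _ := mul_le_mul_of_nonneg_right this (by positivity)
    _ = (5184 + 2 * Real.exp 1024) * (((n.factorial : ℝ) ^ 3 * (n.factorial : ℝ) ^ (k - 3)) / n ^ 2) := by
        ring
    _ = _ := by rw [← pow_add]; congr 4; omega

lemma case_one {k : ℕ} (hk : 3 ≤ k) (hn : 2 ≤ n) :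
    ∑ g : Perm (Fin n) × Perm (Fin n) with g ≠ 1, (#(sols k g 1) : ℝ) ≤
      ((2 * Real.exp 1024) ^ (k - 3) * (4 * Real.exp 1024)) *
        ((n.factorial : ℝ) ^ k / n ^ (max 2 (k - 4))) := by
  have h1 : ∀ g : Perm (Fin n) × Perm (Fin n), (#(sols k g 1) : ℝ) ≤
      #(fixS g) * (centN g.1 : ℝ) ^ (k - 1) := by
    intro g
    have := sols_card_le g 1 (univ : Finset (Fin k)) (fun i => ⟨0, mem_univ _⟩)
      (fun i => fixS g) (by
      intro a ha i _
      have := sols_mem_fix ha 1 i (by simp)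
      simpa using this)
    have e1 : #(fixS g) ^ k = #(fixS g) * #(fixS g) ^ (k - 1) := by
      rw [← pow_succ']; congr 1; omega
    rw [Finset.prod_const, Finset.card_univ, Fintype.card_fin, e1] at this
    have h2 := this.trans (Nat.mul_le_mul_left _ (Nat.pow_le_pow_left (fixS_card_le g) _))
    exact_mod_cast h2
  have hM : ∑ g : Perm (Fin n) with g ≠ 1, (centN g : ℝ) ^ (k - 1) ≤
      (2 * Real.exp 1024 * (n.factorial / n ^ 2)) ^ (k - 3) *
        (4 * Real.exp 1024 * ((n.factorial : ℝ) ^ 2 / n ^ 2)) := by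
    calc _ ≤ ∑ g : Perm (Fin n) with g ≠ 1,
          (2 * Real.exp 1024 * (n.factorial / n ^ 2)) ^ (k - 3) * (centN g : ℝ) ^ 2 := by
          apply Finset.sum_le_sum
          intro g hg
          rw [show k - 1 = (k - 3) + 2 by omega, pow_add]
          have := cent_max g (Finset.mem_filter.1 hg).2
          gcongr
      _ ≤ _ := by
          rw [← Finset.mul_sum]
          exact mul_le_mul_of_nonneg_left (cent_sq hn) (by positivity)
  calc _ ≤ ∑ g : Perm (Fin n) × Perm (Fin n) with g ≠ 1,
        (#(fixS g) : ℝ) * (fun g => (centN g : ℝ) ^ (k - 1)) g.1 :=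
        Finset.sum_le_sum fun g _ => h1 g
    _ = n.factorial * ∑ g : Perm (Fin n) with g ≠ 1, (centN g : ℝ) ^ (k - 1) :=
        sum_weight (fun g => (centN g : ℝ) ^ (k - 1))
    _ ≤ n.factorial * ((2 * Real.exp 1024 * (n.factorial / n ^ 2)) ^ (k - 3) *
        (4 * Real.exp 1024 * ((n.factorial : ℝ) ^ 2 / n ^ 2))) := by gcongr
    _ = ((2 * Real.exp 1024) ^ (k - 3) * (4 * Real.exp 1024)) *
        ((n.factorial : ℝ) ^ (k - 3 + 3) / n ^ (2 * (k - 3) + 2)) := by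
        rw [mul_pow _ (_ / _), div_pow, ← pow_mul, pow_add _ (k-3) 3, pow_add (n:ℝ)]
        field_simp
    _ ≤ _ := by
        rw [show k - 3 + 3 = k by omega]
        exact mul_le_mul_of_nonneg_left
          (inv_pow_le (by omega) (by omega) (by positivity)) (by positivity)

lemma case_swap {k : ℕ} (hk : 3 ≤ k) (hn : 2 ≤ n) (π : Perm (Fin k)) (hπ : π.IsSwap) :
    ∑ g : Perm (Fin n) × Perm (Fin n) with g ≠ 1, (#(sols k g π) : ℝ) ≤
      ((2 * Real.exp 1024) ^ (k - 3) + (5184 + 2 * Real.exp 1024)) *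
        ((n.factorial : ℝ) ^ k / n ^ (max 2 (k - 4))) := by
  obtain ⟨e, d, hed, rfl⟩ := hπ
  have h1 : ∀ g : Perm (Fin n) × Perm (Fin n), (#(sols k g (swap e d)) : ℝ) ≤
      #(fixS g) * ((centN g.1 : ℝ) ^ (k - 3) * centN (g.1 ^ 2)) := by
    intro g
    have he : e ∈ ({d}ᶜ : Finset (Fin k)) := by simpa using hed
    have := sols_card_le g (swap e d) ({d}ᶜ : Finset (Fin k)) (by
        intro i
        by_cases h : i = d
        · exact ⟨1, by subst h; simpa using hed⟩
        · exact ⟨0, by simpa using h⟩)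
      (fun i => if i = e then fixS (g ^ 2) else fixS g) (by
      intro a ha i hi
      split_ifs with h
      · exact sols_mem_fix ha 2 i (by simp [sq])
      · have := sols_mem_fix ha 1 i (by
          rw [pow_one]; exact swap_apply_of_ne_of_ne h (by simpa using hi))
        simpa using this)
    rw [← Finset.mul_prod_erase _ _ he, if_pos rfl,
      Finset.prod_congr rfl (g := fun _ => #(fixS g)), Finset.prod_const,
      Finset.card_erase_of_mem he, Finset.card_compl, Finset.card_singleton, Fintype.card_fin,
      show k - 1 - 1 = (k - 3) + 1 by omega, pow_succ' (#(fixS g))] at this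
    · have h2 : #(fixS (g ^ 2)) ≤ centN (g.1 ^ 2) := fixS_card_le (g ^ 2)
      have h3 : #(fixS g) ≤ centN g.1 := fixS_card_le g
      have h4 : #(sols k g (swap e d)) ≤ centN (g.1 ^ 2) * (#(fixS g) * centN g.1 ^ (k - 3)) :=
        this.trans (by gcongr)
      have h5 : (#(sols k g (swap e d)) : ℝ) ≤
        centN (g.1 ^ 2) * (#(fixS g) * centN g.1 ^ (k - 3)) := by exact_mod_cast h4
      linarith
    · intro x hx
      rw [if_neg (Finset.ne_of_mem_erase hx)]
  have hM : ∑ g : Perm (Fin n) with g ≠ 1, ((centN g : ℝ) ^ (k - 3) * centN (g ^ 2)) ≤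
      ((2 * Real.exp 1024) ^ (k - 3) + (5184 + 2 * Real.exp 1024)) *
        ((n.factorial : ℝ) ^ (k - 1) / n ^ (max 2 (k - 4))) := by
    rcases Nat.eq_or_lt_of_le hk with h3 | h3
    · subst h3
      have := sum_cent_pow (n := n) (by omega) 2 (Or.inl rfl)
      calc _ ≤ ∑ g : Perm (Fin n), ((centN g : ℝ) ^ (3 - 3) * centN (g ^ 2)) :=
            Finset.sum_le_sum_of_subset_of_nonneg (Finset.filter_subset _ _)
              (fun _ _ _ => by positivity)
        _ ≤ (5184 + 2 * Real.exp 1024) * ((n.factorial : ℝ) ^ 2 / n ^ 2) := by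
            simpa using this
        _ ≤ _ := by
            change _ ≤ _ * ((n.factorial : ℝ) ^ 2 / n ^ 2)
            refine mul_le_mul_of_nonneg_right ?_ (by positivity)
            simp
    · calc _ ≤ ∑ g : Perm (Fin n) with g ≠ 1,
            ((2 * Real.exp 1024 * (n.factorial / n ^ 2)) ^ (k - 3) * n.factorial) := by
            apply Finset.sum_le_sum
            intro g hg
            have := cent_max g (Finset.mem_filter.1 hg).2
            have := cent_le (g ^ 2)
            gcongr
        _ ≤ ∑ g : Perm (Fin n),
            ((2 * Real.exp 1024 * (n.factorial / n ^ 2)) ^ (k - 3) * n.factorial) :=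
            Finset.sum_le_sum_of_subset_of_nonneg (Finset.filter_subset _ _)
              (fun _ _ _ => by positivity)
        _ = (2 * Real.exp 1024) ^ (k - 3) *
            ((n.factorial : ℝ) ^ (k - 3 + 2) / n ^ (2 * (k - 3))) := by
            rw [Finset.sum_const, Finset.card_univ, cardG, nsmul_eq_mul, mul_pow _ (_ / _),
              div_pow, ← pow_mul, pow_add _ (k-3) 2]
            ring
        _ ≤ (2 * Real.exp 1024) ^ (k - 3) *
            ((n.factorial : ℝ) ^ (k - 1) / n ^ (max 2 (k - 4))) := by
            rw [show k - 3 + 2 = k - 1 by omega]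
            exact mul_le_mul_of_nonneg_left
              (inv_pow_le (by omega) (by omega) (by positivity)) (by positivity)
        _ ≤ _ := by
            gcongr
            have := Real.exp_pos 1024
            linarith
  calc _ ≤ ∑ g : Perm (Fin n) × Perm (Fin n) with g ≠ 1,
        (#(fixS g) : ℝ) * (fun g => (centN g : ℝ) ^ (k - 3) * centN (g ^ 2)) g.1 :=
        Finset.sum_le_sum fun g _ => h1 g
    _ = n.factorial * ∑ g : Perm (Fin n) with g ≠ 1, ((centN g : ℝ) ^ (k - 3) * centN (g ^ 2)) :=
        sum_weight (fun g => (centN g : ℝ) ^ (k - 3) * centN (g ^ 2))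
    _ ≤ n.factorial * (((2 * Real.exp 1024) ^ (k - 3) + (5184 + 2 * Real.exp 1024)) *
        ((n.factorial : ℝ) ^ (k - 1) / n ^ (max 2 (k - 4)))) := by gcongr
    _ = ((2 * Real.exp 1024) ^ (k - 3) + (5184 + 2 * Real.exp 1024)) *
        (((n.factorial : ℝ) ^ (k - 1 + 1)) / n ^ (max 2 (k - 4))) := by
        rw [pow_succ]; ring
    _ = _ := by rw [show k - 1 + 1 = k by omega]

lemma low_le {k : ℕ} (hk : 3 ≤ k) (hn : 1 ≤ n) (m : ℕ) : (n.factorial : ℝ) ^ (k - 1) ≤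
    (m.factorial * Real.exp (Real.exp 1)) * ((n.factorial : ℝ) ^ k / n ^ m) := by
  have h := pow_le_fact m n
  have hn' : (0:ℝ) < n ^ m := by positivity
  rw [mul_div_assoc', le_div_iff₀ hn']
  calc _ ≤ (n.factorial : ℝ) ^ (k - 1) *
        ((m.factorial * Real.exp (Real.exp 1)) * n.factorial) := by gcongr
    _ = (m.factorial * Real.exp (Real.exp 1)) * (n.factorial : ℝ) ^ (k - 1 + 1) := by
        rw [pow_succ]; ring
    _ = _ := by rw [show k - 1 + 1 = k by omega]

end bounds

lemma dec3 : ∀ π : Perm (Fin 3), (∀ i, π i ≠ i) → π ^ 3 = 1 := by decide +kernel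

lemma dec4 : ∀ π : Perm (Fin 4), (∀ i, π i ≠ i) →
    π ^ 2 = 1 ∨ ∀ i, ∃ j : Fin 4, (π ^ (j : ℕ)) i = 0 := by decide +kernel

lemma all_cases (k : ℕ) (hk : 3 ≤ k) : ∃ K : ℝ, 0 < K ∧ ∀ n : ℕ, 2 ≤ n → ∀ π : Perm (Fin k),
    ∑ g : Perm (Fin n) × Perm (Fin n) with g ≠ 1, (#(sols k g π) : ℝ) ≤
      K * ((n.factorial : ℝ) ^ k / n ^ (max 2 (k - 4))) := by
  set K1 : ℝ := (2 * Real.exp 1024) ^ (k - 3) * (4 * Real.exp 1024) with hK1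
  set K2 : ℝ := (2 * Real.exp 1024) ^ (k - 3) + (5184 + 2 * Real.exp 1024) with hK2
  set K3 : ℝ := (max 2 (k - 4)).factorial * Real.exp (Real.exp 1) with hK3
  set K4 : ℝ := 5184 + 2 * Real.exp 1024 with hK4
  have p1 : 0 < K1 := by positivity
  have p2 : 0 < K2 := by positivity
  have p3 : 0 < K3 := by positivity
  have p4 : 0 < K4 := by positivity
  refine ⟨K1 + K2 + K3 + K4, by positivity, ?_⟩
  intro n hn π
  set X : ℝ := (n.factorial : ℝ) ^ k / n ^ (max 2 (k - 4)) with hX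
  have hX0 : 0 ≤ X := by positivity
  have mono : ∀ K, K ≤ K1 + K2 + K3 + K4 → K * X ≤ (K1 + K2 + K3 + K4) * X :=
    fun K h => mul_le_mul_of_nonneg_right h hX0
  have low := low_le (n := n) hk (by omega) (max 2 (k - 4))
  obtain ⟨E, hE, hEc⟩ := reps_exist π
  by_cases h0 : π = 1
  · subst h0
    exact (case_one hk hn).trans (mono K1 (by linarith))
  by_cases h2 : #π.support = 2
  · exact (case_swap hk hn π (Perm.card_support_eq_two.1 h2)).trans (mono K2 (by linarith))
  have hs : 2 ≤ #π.support := Perm.two_le_card_support_of_ne_one h0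
  by_cases h5 : 5 ≤ #π.support
  · exact (case_small hk π E hE (by omega)).trans (low.trans (mono K3 (by linarith)))
  by_cases hfix : ∃ i, π i = i
  · obtain ⟨i, hi⟩ := hfix
    exact (case_fix hk π E hE (by omega) i hi).trans (low.trans (mono K3 (by linarith)))
  push Not at hfix
  have hsupp : #π.support = k := by
    have : π.support = univ := by
      ext i; simpa using hfix i
    rw [this]; simp
  have hpow : ∀ p, (p = 2 ∨ p = 3) → π ^ p = 1 →
      ∑ g : Perm (Fin n) × Perm (Fin n) with g ≠ 1, (#(sols k g π) : ℝ) ≤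
        (K1 + K2 + K3 + K4) * X := by
    intro p hp hpp
    refine (case_pow hk (by omega) π E hE (by omega) p hp hpp).trans ?_
    have : max 2 (k - 4) = 2 := by omega
    have e : X = (n.factorial : ℝ) ^ k / n ^ 2 := by rw [hX, this]
    rw [← e]
    exact mono K4 (by linarith)
  have hk34 : k = 3 ∨ k = 4 := by omega
  rcases hk34 with h | h
  · subst h
    exact hpow 3 (Or.inr rfl) (dec3 π hfix)
  · subst h
    rcases dec4 π hfix with h | h
    · exact hpow 2 (Or.inl rfl) h
    · refine (case_small hk π {0} ?_ (by simp)).trans (low.trans (mono K3 (by linarith)))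
      intro i
      obtain ⟨j, hj⟩ := h i
      exact ⟨j, by simpa using hj⟩

lemma choose_lower (k N : ℕ) (hk : 1 ≤ k) (h : k ≤ N) :
    (N:ℝ) ^ k ≤ ((k:ℝ) ^ k * k.factorial) * N.choose k := by
  have h1 := Nat.pow_sub_le_descFactorial N k
  rw [Nat.descFactorial_eq_factorial_mul_choose] at h1
  have h2 : N ≤ k * (N + 1 - k) := by
    obtain ⟨t, rfl⟩ := Nat.exists_eq_add_of_le h
    rw [show k + t + 1 - k = t + 1 by omega]
    nlinarith
  have h3 : N ^ k ≤ k ^ k * (k.factorial * N.choose k) := by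
    calc N ^ k ≤ (k * (N + 1 - k)) ^ k := Nat.pow_le_pow_left h2 k
      _ = k ^ k * (N + 1 - k) ^ k := mul_pow _ _ _
      _ ≤ _ := Nat.mul_le_mul_left _ h1
  rw [← mul_assoc] at h3
  exact_mod_cast h3

/-- For each fixed `k ≥ 3` there is `C_k > 0` such that for all `n` with `n! ≥ k + 3`,
`T(n,k) ≤ (1 + C_k·n^{−max(2, k−4)})·(1/n!²)·binom(n!,k)`. -/
theorem T_upper_bound_fixed_k (k : ℕ) (hk : 3 ≤ k) :
    ∃ C : ℝ, 0 < C ∧ ∀ n : ℕ, k + 3 ≤ n.factorial →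
      (T n k : ℝ) ≤
        (1 + C / (n : ℝ) ^ (max 2 (k - 4))) *
          ((n.factorial.choose k : ℝ) / (n.factorial : ℝ) ^ 2) := by
  obtain ⟨K, hK, hall⟩ := all_cases k hk
  refine ⟨(Fintype.card (Perm (Fin k)) * K) * ((k:ℝ) ^ k * k.factorial), ?_, ?_⟩
  · have : 0 < Fintype.card (Perm (Fin k)) := Fintype.card_pos
    have : 0 < k := by omega
    positivity
  intro n hn
  have hn2 : 2 ≤ n := by
    by_contra h
    have : n.factorial ≤ Nat.factorial 1 := Nat.factorial_le (by omega)
    simp at this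
    omega
  have hB := T_burnside n k
  have hB' : (T n k : ℝ) * (n.factorial : ℝ) ^ 2 ≤ n.factorial.choose k +
      ∑ π : Perm (Fin k), ∑ g : Perm (Fin n) × Perm (Fin n) with g ≠ 1,
        (#(sols k g π) : ℝ) := by exact_mod_cast hB
  have hS : ∑ π : Perm (Fin k), ∑ g : Perm (Fin n) × Perm (Fin n) with g ≠ 1,
        (#(sols k g π) : ℝ) ≤ Fintype.card (Perm (Fin k)) *
        (K * ((n.factorial : ℝ) ^ k / n ^ (max 2 (k - 4)))) := by
    refine (Finset.sum_le_sum fun π _ => hall n hn2 π).trans (le_of_eq ?_)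
    rw [Finset.sum_const, Finset.card_univ, nsmul_eq_mul]
  have hc := choose_lower k n.factorial (by omega) (by omega)
  have hf : (0:ℝ) < (n.factorial : ℝ) ^ 2 := by positivity
  rw [mul_div_assoc', le_div_iff₀ hf]
  have h3 : (Fintype.card (Perm (Fin k)) : ℝ) *
        (K * ((n.factorial : ℝ) ^ k / n ^ (max 2 (k - 4)))) ≤
      Fintype.card (Perm (Fin k)) *
        (K * ((((k:ℝ) ^ k * k.factorial) * n.factorial.choose k) / n ^ (max 2 (k - 4)))) := by gcongr
  calc _ ≤ _ := hB'
    _ ≤ n.factorial.choose k + Fintype.card (Perm (Fin k)) *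
        (K * ((((k:ℝ) ^ k * k.factorial) * n.factorial.choose k) / n ^ (max 2 (k - 4)))) := by linarith
    _ = _ := by ring
end
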